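/- arXiv:1901.00043 — 2 statements merged into one kernel-verified Lean document; each statement's English description precedes it below -/
import Mathlib

section
/- Let G be a finite connected nonempty graph that is claw-free and bull-free. Then at least one of the following holds: (i) there exists n ≥ 4 such that G is an expansion of the path of length n (the path with n+1 vertices); (ii) there exists k ≥ 6 such that G is an expansion of the cycle of length k; (iii) the independence number of G is at most 2, i.e., G is the complement of a triangle-free graph. -/
/-- A graph is claw-free: no induced `K_{1,3}`. -/
def ClawFree {V : Type*} (G : SimpleGraph V) : Prop :=
  ¬ ∃ v a b c : V, a ≠ b ∧ a ≠ c ∧ b ≠ c ∧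
    G.Adj v a ∧ G.Adj v b ∧ G.Adj v c ∧ ¬ G.Adj a b ∧ ¬ G.Adj a c ∧ ¬ G.Adj b c

/-- A graph is bull-free: no induced bull (triangle `a b c` with pendants `d` at `a`
and `e` at `b`). -/
def BullFree {V : Type*} (G : SimpleGraph V) : Prop :=
  ¬ ∃ a b c d e : V, a ≠ e ∧ b ≠ d ∧ c ≠ d ∧ c ≠ e ∧ d ≠ e ∧
    G.Adj a b ∧ G.Adj b c ∧ G.Adj c a ∧ G.Adj a d ∧ G.Adj b e ∧
    ¬ G.Adj b d ∧ ¬ G.Adj c d ∧ ¬ G.Adj a e ∧ ¬ G.Adj c e ∧ ¬ G.Adj d e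
/-- `G` is an expansion of the path with `n + 1` vertices. -/
def IsPathExpansion {V : Type*} (G : SimpleGraph V) (n : ℕ) : Prop :=
  ∃ f : V → Fin (n + 1), Function.Surjective f ∧
    ∀ x y : V, x ≠ y →
      (G.Adj x y ↔ ((f x : ℕ) ≤ (f y : ℕ) + 1 ∧ (f y : ℕ) ≤ (f x : ℕ) + 1))

/-- `G` is an expansion of the cycle of length `k`. -/
def IsCycleExpansion {V : Type*} (G : SimpleGraph V) (k : ℕ) : Prop :=
  ∃ f : V → ZMod k, Function.Surjective f ∧
    ∀ x y : V, x ≠ y →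
      (G.Adj x y ↔ (f x = f y ∨ f x - f y = 1 ∨ f y - f x = 1))

/-- The closed adjacency relation of the path on `n + 1` vertices. -/
def PathRel (n : ℕ) (a b : Fin (n + 1)) : Prop :=
  (a : ℕ) ≤ (b : ℕ) + 1 ∧ (b : ℕ) ≤ (a : ℕ) + 1

/-- Two elements are equal or differ by `e`; on `ZMod k` with `e = 1` this is the closed adjacency
relation of the cycle of length `k`. -/
def StepRel {A : Type*} [CommRing A] (e a b : A) : Prop :=
  a = b ∨ a - b = e ∨ b - a = e

/-- No nontrivial multiple of `e` by a number less than six vanishes. -/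
def SmallMultiplesNeZero {A : Type*} [CommRing A] (e : A) : Prop :=
  e ≠ 0 ∧ 2 * e ≠ 0 ∧ 3 * e ≠ 0 ∧ 4 * e ≠ 0 ∧ 5 * e ≠ 0

/-- `c` embeds the graph with closed adjacency relation `N` as an induced subgraph of `G`. -/
def IsInducedCopy {V ι : Type*} (G : SimpleGraph V) (N : ι → ι → Prop) (c : ι → V) : Prop :=
  Function.Injective c ∧ ∀ a b, a ≠ b → (G.Adj (c a) (c b) ↔ N a b)

/-- Every vertex outside an induced copy of `N` that has a neighbour in the copy sees exactly the
closed neighbourhood of some vertex of the copy. -/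
def AttachesAsTwin {V ι : Type*} (G : SimpleGraph V) (N : ι → ι → Prop) : Prop :=
  ∀ c, IsInducedCopy G N c → ∀ w, (∀ m, w ≠ c m) → (∃ m, G.Adj w (c m)) →
    ∃ j, ∀ m, G.Adj w (c m) ↔ N m j

/-- The closed neighbourhood of `j` with `i` deleted determines whether `i` lies in it. -/
def Determines {ι : Type*} (N : ι → ι → Prop) (i j : ι) : Prop :=
  ∀ j', (∀ m, m ≠ i → (N m j ↔ N m j')) → (N i j ↔ N i j')

section Expansion

variable {V ι : Type*} {G : SimpleGraph V} {N : ι → ι → Prop}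

theorem IsInducedCopy.ne_and_not_adj {c : ι → V} (hc : IsInducedCopy G N c) {a b : ι}
    (hab : a ≠ b) (h : ¬ N a b) : c a ≠ c b ∧ ¬ G.Adj (c a) (c b) :=
  ⟨hc.1.ne hab, by rwa [hc.2 a b hab]⟩

theorem IsInducedCopy.update [DecidableEq ι] {c : ι → V} (hc : IsInducedCopy G N c)
    (hsymm : ∀ a b, N a b → N b a) {v : V} (hv : ∀ m, v ≠ c m) {i : ι}
    (hi : ∀ m, G.Adj v (c m) ↔ N m i) : IsInducedCopy G N (Function.update c i v) := by
  obtain ⟨hinj, hadj⟩ := hc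
  constructor
  · intro a b hab
    have := @hinj a b
    have := hv a
    have := hv b
    simp only [Function.update_apply] at hab
    grind
  · intro a b hab
    have := hadj a b hab
    have := hi a
    have := hi b
    have := hsymm a b
    have := hsymm b a
    have := G.adj_comm v (c a)
    simp only [Function.update_apply]
    grind

theorem adj_iff_of_determines {c : ι → V} (hc : IsInducedCopy G N c)
    (hsymm : ∀ a b, N a b → N b a) (hne : ∀ i j, ∃ m, m ≠ i ∧ N m j)
    (hatt : AttachesAsTwin G N) {x y : V} (hxy : x ≠ y) (hx : ∀ m, x ≠ c m) (hy : ∀ m, y ≠ c m)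
    {i j : ι} (hi : ∀ m, G.Adj x (c m) ↔ N m i) (hj : ∀ m, G.Adj y (c m) ↔ N m j)
    (hdet : Determines N i j) : G.Adj x y ↔ N i j := by
  classical
  obtain ⟨m, hmi, hmj⟩ := hne i j
  obtain ⟨j', hj'⟩ := hatt _ (hc.update hsymm hx hi) y
    (fun m => by simp only [Function.update_apply]; grind)
    ⟨m, by rw [Function.update_of_ne hmi]; exact (hj m).2 hmj⟩
  have h := hdet j' fun m hm => by
    rw [← hj', Function.update_of_ne hm, hj]
  rw [h, ← hj', Function.update_self, G.adj_comm]

theorem exists_eq_or_adj_of_connected {c : ι → V} (hconn : G.Connected) (hc : IsInducedCopy G N c)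
    (hsymm : ∀ a b, N a b → N b a) (hne : ∀ i j, ∃ m, m ≠ i ∧ N m j)
    (hatt : AttachesAsTwin G N) (i₀ : ι) (v : V) : ∃ m, v = c m ∨ G.Adj v (c m) := by
  classical
  have step : ∀ v w : V, G.Adj v w → (∃ m, v = c m ∨ G.Adj v (c m)) →
      ∃ m, w = c m ∨ G.Adj w (c m) := by
    rintro v w hvw ⟨m, hm⟩
    by_cases hv : ∃ m, v = c m
    · obtain ⟨m, rfl⟩ := hv
      exact ⟨m, Or.inr hvw.symm⟩
    by_cases hw : ∃ m, w = c m
    · obtain ⟨m, hw⟩ := hw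
      exact ⟨m, Or.inl hw⟩
    push Not at hv hw
    obtain ⟨j, hj⟩ := hatt c hc v hv ⟨m, by grind⟩
    obtain ⟨j', hj'⟩ := hatt _ (hc.update hsymm hv hj) w
      (fun m => by
        have := hvw.ne
        simp only [Function.update_apply]; grind)
      ⟨j, by simpa using hvw.symm⟩
    obtain ⟨m, hmj, hm⟩ := hne j j'
    refine ⟨m, Or.inr ?_⟩
    rw [← hj', Function.update_of_ne hmj] at hm
    exact hm
  obtain ⟨p⟩ := hconn.preconnected (c i₀) v
  have key : ∀ {u v : V} (_ : G.Walk u v), (∃ m, u = c m ∨ G.Adj u (c m)) →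
      ∃ m, v = c m ∨ G.Adj v (c m) := by
    intro u v p
    induction p with
    | nil => exact id
    | cons h _ ih => exact fun hu => ih (step _ _ h hu)
  exact key p ⟨i₀, Or.inl rfl⟩

theorem exists_expansion {c : ι → V} (hconn : G.Connected) (hc : IsInducedCopy G N c)
    (hsymm : ∀ a b, N a b → N b a) (hne : ∀ i j, ∃ m, m ≠ i ∧ N m j)
    (hdet : ∀ i j, Determines N i j ∨ Determines N j i)
    (hatt : AttachesAsTwin G N) (i₀ : ι) :
    ∃ f : V → ι, Function.Surjective f ∧ ∀ x y, x ≠ y → (G.Adj x y ↔ N (f x) (f y)) := by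
  have hf : ∀ v, ∃ j, (∀ m, v ≠ c m → (G.Adj v (c m) ↔ N m j)) ∧ ∀ m, v = c m → j = m := by
    intro v
    by_cases hv : ∃ m, v = c m
    · obtain ⟨i, rfl⟩ := hv
      exact ⟨i, fun m hm => by rw [G.adj_comm]; exact hc.2 m i (by grind), fun m hm => hc.1 hm⟩
    push Not at hv
    obtain ⟨m, hm⟩ := exists_eq_or_adj_of_connected hconn hc hsymm hne hatt i₀ v
    obtain ⟨j, hj⟩ := hatt c hc v hv ⟨m, by grind⟩
    exact ⟨j, fun m _ => hj m, fun m hm => absurd hm (hv m)⟩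
  choose f hf hfc using hf
  refine ⟨f, fun i => ⟨c i, hfc _ _ rfl⟩, fun x y hxy => ?_⟩
  by_cases hx : ∃ m, x = c m
  · obtain ⟨a, rfl⟩ := hx
    rw [hfc _ a rfl, G.adj_comm]
    exact hf y a hxy.symm
  by_cases hy : ∃ m, y = c m
  · obtain ⟨b, rfl⟩ := hy
    rw [hfc _ b rfl, hf x b hxy]
    exact ⟨hsymm _ _, hsymm _ _⟩
  push Not at hx hy
  have hfx m := hf x m (hx m)
  have hfy m := hf y m (hy m)
  rcases hdet (f x) (f y) with h | h
  · exact adj_iff_of_determines hc hsymm hne hatt hxy hx hy hfx hfy h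
  · rw [G.adj_comm, adj_iff_of_determines hc hsymm hne hatt hxy.symm hy hx hfy hfx h]
    exact ⟨hsymm _ _, hsymm _ _⟩

end Expansion

section Forbidden

variable {V : Type*} {G : SimpleGraph V}

theorem ClawFree.exists_adj (hclaw : ClawFree G) {v a b c : V} (hab : a ≠ b) (hac : a ≠ c)
    (hbc : b ≠ c) (hva : G.Adj v a) (hvb : G.Adj v b) (hvc : G.Adj v c) :
    G.Adj a b ∨ G.Adj a c ∨ G.Adj b c := by
  by_contra! h
  exact hclaw ⟨v, a, b, c, hab, hac, hbc, hva, hvb, hvc, h⟩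

theorem BullFree.exists_adj (hbull : BullFree G) {a b c d e : V} (hcd : c ≠ d) (hce : c ≠ e)
    (hab : G.Adj a b) (hbc : G.Adj b c) (hca : G.Adj c a) (had : G.Adj a d) (hbe : G.Adj b e)
    (hde : d ≠ e) :
    G.Adj b d ∨ G.Adj c d ∨ G.Adj a e ∨ G.Adj c e ∨ G.Adj d e := by
  by_contra! h
  have := G.adj_comm
  exact hbull ⟨a, b, c, d, e, by rintro rfl; grind, by rintro rfl; grind, hcd, hce, hde, hab, hbc,
    hca, had, hbe, h⟩

end Forbidden

section Cycle

variable {A : Type*} [CommRing A] {e : A}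

theorem stepRel_symm (a b : A) (h : StepRel e a b) : StepRel e b a := by
  unfold StepRel at *
  tauto

theorem stepRel_exists_ne (he : SmallMultiplesNeZero e) (i j : A) :
    ∃ m, m ≠ i ∧ StepRel e m j := by
  unfold SmallMultiplesNeZero at he
  by_cases h : j = i
  · exact ⟨j + e, by grind, by unfold StepRel; grind⟩
  · exact ⟨j, h, Or.inl rfl⟩

theorem stepRel_determines (he : SmallMultiplesNeZero e) (i j : A) :
    Determines (StepRel e) i j := by
  intro j' h
  by_cases hj : j = j'
  · rw [hj]
  have key : ∀ m, m ≠ i → (StepRel e m j ↔ StepRel e m j') := h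
  have hl : ∀ a : A, StepRel e (a - e) a := fun a => by unfold StepRel; grind
  have hr : ∀ a : A, StepRel e (a + e) a := fun a => by unfold StepRel; grind
  have a1 := or_iff_not_imp_left.2 fun h => (key (j - e) h).1 (hl j)
  have a2 := or_iff_not_imp_left.2 fun h => (key j h).1 (Or.inl rfl)
  have a3 := or_iff_not_imp_left.2 fun h => (key (j + e) h).1 (hr j)
  have b1 := or_iff_not_imp_left.2 fun h => (key (j' - e) h).2 (hl j')
  have b2 := or_iff_not_imp_left.2 fun h => (key j' h).2 (Or.inl rfl)
  have b3 := or_iff_not_imp_left.2 fun h => (key (j' + e) h).2 (hr j')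
  clear h key hl hr
  unfold StepRel SmallMultiplesNeZero at *
  grind

variable {V : Type*} {G : SimpleGraph V}

theorem stepRel_attachesAsTwin (hclaw : ClawFree G) (hbull : BullFree G)
    (he : SmallMultiplesNeZero e) : AttachesAsTwin G (StepRel e) := by
  rintro c hc w hw ⟨i₀, hi₀⟩
  unfold SmallMultiplesNeZero at he
  have hs : ∀ i j, j = i + e → G.Adj (c i) (c j) :=
    fun i j h => (hc.2 _ _ (by grind)).2 (by unfold StepRel; grind)
  have hn : ∀ i j, (j = i + 2 * e ∨ j = i + 3 * e ∨ j = i + 4 * e) →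
      c i ≠ c j ∧ ¬ G.Adj (c i) (c j) :=
    fun i j h => hc.ne_and_not_adj (by grind) (by unfold StepRel; grind)
  have hsym := G.adj_comm
  have claw1 : ∀ i, G.Adj w (c i) → G.Adj w (c (i - e)) ∨ G.Adj w (c (i + e)) := by
    intro i hi
    have h := hclaw.exists_adj (v := c i) (hw (i - e)) (hw (i + e))
      (hn (i - e) (i + e) (by grind)).1 hi.symm (hs (i - e) i (by grind)).symm
      (hs i (i + e) (by grind))
    have := hn (i - e) (i + e) (by grind)
    tauto
  have bull1 : ∀ i, G.Adj w (c i) → G.Adj w (c (i + e)) →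
      G.Adj w (c (i - e)) ∨ G.Adj w (c (i + 2 * e)) := by
    intro i hi hi'
    have h := hbull.exists_adj (hw (i - e)) (hw (i + 2 * e)) (hs i (i + e) rfl) hi'.symm hi
      (hs (i - e) i (by grind)).symm (hs (i + e) (i + 2 * e) (by grind))
      (hn (i - e) (i + 2 * e) (by grind)).1
    have := hn (i - e) (i + 2 * e) (by grind)
    have := hn (i - e) (i + e) (by grind)
    have := hn i (i + 2 * e) (by grind)
    grind
  obtain ⟨j, hj1, hj2, hj3⟩ : ∃ j, G.Adj w (c (j - e)) ∧ G.Adj w (c j) ∧ G.Adj w (c (j + e)) := by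
    have key : ∀ i, G.Adj w (c i) → G.Adj w (c (i + e)) →
        ∃ j, G.Adj w (c (j - e)) ∧ G.Adj w (c j) ∧ G.Adj w (c (j + e)) := by
      intro i hi hi'
      rcases bull1 i hi hi' with h | h
      · exact ⟨i, h, hi, hi'⟩
      · exact ⟨i + e, by ring_nf; exact hi, hi', by ring_nf at h ⊢; exact h⟩
    rcases claw1 i₀ hi₀ with h | h
    · exact key _ h (by ring_nf; exact hi₀)
    · exact key _ hi₀ h
  have claw3 : ∀ m, G.Adj w (c m) → StepRel e m (j - e) ∨ StepRel e m (j + e) := by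
    intro m hm
    by_contra! h
    have h1 := hc.ne_and_not_adj (fun h' => h.1 (Or.inl h')) h.1
    have h2 := hc.ne_and_not_adj (fun h' => h.2 (Or.inl h')) h.2
    have h3 := hn (j - e) (j + e) (by grind)
    have := hclaw.exists_adj h1.1 h2.1 h3.1 hm hj1 hj3
    tauto
  have far_right : ¬ G.Adj w (c (j + 2 * e)) := by
    intro hm
    have h5 : ¬ G.Adj w (c (j + 3 * e)) := by
      intro h
      have := claw3 _ h
      unfold StepRel at this
      grind
    have h := hbull.exists_adj (a := w) (b := c (j + 2 * e)) (c := c (j + e)) (d := c (j - e))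
      (e := c (j + 3 * e)) (hn (j - e) (j + e) (by grind)).1.symm
      (hn (j + e) (j + 3 * e) (by grind)).1 hm (hs (j + e) (j + 2 * e) (by grind)).symm hj3.symm
      hj1 (hs (j + 2 * e) (j + 3 * e) (by grind)) (hn (j - e) (j + 3 * e) (by grind)).1
    have := hn (j - e) (j + 2 * e) (by grind)
    have := hn (j - e) (j + e) (by grind)
    have := hn (j + e) (j + 3 * e) (by grind)
    have := hn (j - e) (j + 3 * e) (by grind)
    grind
  have far_left : ¬ G.Adj w (c (j - 2 * e)) := by
    intro hm
    have h5 : ¬ G.Adj w (c (j - 3 * e)) := by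
      intro h
      have := claw3 _ h
      unfold StepRel at this
      grind
    have h := hbull.exists_adj (a := w) (b := c (j - 2 * e)) (c := c (j - e)) (d := c (j + e))
      (e := c (j - 3 * e)) (hn (j - e) (j + e) (by grind)).1
      (hn (j - 3 * e) (j - e) (by grind)).1.symm hm (hs (j - 2 * e) (j - e) (by grind)) hj1.symm
      hj3 (hs (j - 3 * e) (j - 2 * e) (by grind)).symm (hn (j - 3 * e) (j + e) (by grind)).1.symm
    have := hn (j - 2 * e) (j + e) (by grind)
    have := hn (j - e) (j + e) (by grind)
    have := hn (j - 3 * e) (j - e) (by grind)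
    have := hn (j - 3 * e) (j + e) (by grind)
    grind
  refine ⟨j, fun m => ⟨fun hm => ?_, ?_⟩⟩
  · have := claw3 m hm
    unfold StepRel at *
    have hne2 : m ≠ j + 2 * e := by rintro rfl; exact far_right hm
    have hne1 : m ≠ j - 2 * e := by rintro rfl; exact far_left hm
    grind
  · unfold StepRel
    rintro (rfl | h | h)
    · exact hj2
    · rwa [show m = j + e by grind]
    · rwa [show m = j - e by grind]

theorem smallMultiplesNeZero_zmod {k : ℕ} (hk : 6 ≤ k) : SmallMultiplesNeZero (1 : ZMod k) := by
  have h : ∀ m : ℕ, 0 < m → m < 6 → (m : ZMod k) ≠ 0 := by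
    intro m h0 h6 hm
    rw [ZMod.natCast_eq_zero_iff] at hm
    exact absurd (Nat.le_of_dvd h0 hm) (by omega)
  refine ⟨?_, ?_, ?_, ?_, ?_⟩
  · simpa using h 1 (by norm_num) (by norm_num)
  · simpa using h 2 (by norm_num) (by norm_num)
  · simpa using h 3 (by norm_num) (by norm_num)
  · simpa using h 4 (by norm_num) (by norm_num)
  · simpa using h 5 (by norm_num) (by norm_num)

theorem isCycleExpansion_of_isInducedCopy (hconn : G.Connected) (hclaw : ClawFree G)
    (hbull : BullFree G) {k : ℕ} (hk : 6 ≤ k) {c : ZMod k → V}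
    (hc : IsInducedCopy G (StepRel 1) c) : IsCycleExpansion G k :=
  have he := smallMultiplesNeZero_zmod hk
  exists_expansion hconn hc stepRel_symm (stepRel_exists_ne he)
    (fun i j => Or.inl (stepRel_determines he i j)) (stepRel_attachesAsTwin hclaw hbull he) 0

end Cycle

section Path

theorem pathRel_symm {n : ℕ} (a b : Fin (n + 1)) (h : PathRel n a b) : PathRel n b a :=
  And.symm h

theorem pathRel_exists_ne {n : ℕ} (hn : 4 ≤ n) (i j : Fin (n + 1)) :
    ∃ m, m ≠ i ∧ PathRel n m j := by
  by_cases h : j = i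
  · by_cases h0 : (j : ℕ) = 0
    · refine ⟨⟨1, by omega⟩, ?_⟩
      simp only [PathRel, ne_eq, Fin.ext_iff] at *
      omega
    · refine ⟨⟨j - 1, by omega⟩, ?_⟩
      simp only [PathRel, ne_eq, Fin.ext_iff] at *
      omega
  · exact ⟨j, h, by simp [PathRel]⟩

theorem pathRel_determines {n : ℕ} (hn : 4 ≤ n) {i j : Fin (n + 1)}
    (h : ¬ ((i : ℕ) = 2 ∧ (j : ℕ) ≤ 1) ∧ ¬ ((i : ℕ) + 2 = n ∧ n ≤ (j : ℕ) + 1)) :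
    Determines (PathRel n) i j := by
  intro j' hm
  have key : ∀ m, m ≤ n → m ≠ (i : ℕ) →
      ((m ≤ (j : ℕ) + 1 ∧ (j : ℕ) ≤ m + 1) ↔ (m ≤ (j' : ℕ) + 1 ∧ (j' : ℕ) ≤ m + 1)) :=
    fun m hmn hmi => hm ⟨m, by omega⟩ (by simpa [Fin.ext_iff] using hmi)
  unfold PathRel
  obtain ⟨i, hi⟩ := i
  obtain ⟨j, hj⟩ := j
  obtain ⟨j', hj'⟩ := j'
  simp only at *
  have a1 := key (j - 1)
  have a2 := key j
  have a3 := key (j + 1)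
  have b1 := key (j' - 1)
  have b2 := key j'
  have b3 := key (j' + 1)
  clear key hm
  omega

theorem pathRel_determines_or {n : ℕ} (hn : 4 ≤ n) (i j : Fin (n + 1)) :
    Determines (PathRel n) i j ∨ Determines (PathRel n) j i := by
  by_cases h : ¬ ((i : ℕ) = 2 ∧ (j : ℕ) ≤ 1) ∧ ¬ ((i : ℕ) + 2 = n ∧ n ≤ (j : ℕ) + 1)
  · exact Or.inl (pathRel_determines hn h)
  · exact Or.inr (pathRel_determines hn (by omega))

/-- A set of positions on a path satisfying the local conditions imposed by claws and bulls, and not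
reduced to end vertices, is a closed neighbourhood. -/
theorem exists_eq_window {n : ℕ} (hn : 4 ≤ n) {S : ℕ → Prop} (hS : ∀ m, S m → m ≤ n)
    (hne : ∃ m, S m)
    (claw1 : ∀ a, S a → 1 ≤ a → a + 1 ≤ n → S (a - 1) ∨ S (a + 1))
    (claw3 : ∀ a b c, S a → S b → S c → a + 2 ≤ b → b + 2 ≤ c → False)
    (bull1 : ∀ a, S a → S (a + 1) → 1 ≤ a → a + 2 ≤ n → S (a - 1) ∨ S (a + 2))
    (bull_right : ∀ a b, S a → S b → S (b + 1) → b + 2 ≤ n → (a + 2 ≤ b ∨ b + 4 ≤ a) → S (b + 2))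
    (bull_left : ∀ a b, S a → S b → S (b + 1) → 1 ≤ b → (a + 3 ≤ b ∨ b + 3 ≤ a) → S (b - 1))
    (h_zero : ¬ ∀ m, S m ↔ m = 0) (h_last : ¬ ∀ m, S m ↔ m = n)
    (h_ends : ¬ ∀ m, S m ↔ m = 0 ∨ m = n) :
    ∃ j ≤ n, ∀ m ≤ n, (S m ↔ m ≤ j + 1 ∧ j ≤ m + 1) := by
  classical
  obtain ⟨a, ha, hmin⟩ : ∃ a, S a ∧ ∀ m, m < a → ¬ S m :=
    ⟨Nat.find hne, Nat.find_spec hne, fun m hm => Nat.find_min hne hm⟩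
  have han := hS a ha
  rcases Nat.eq_zero_or_pos a with rfl | hpos
  · by_cases h1 : S 1
    · have h4 : ∀ m, 4 ≤ m → ¬ S m := by
        intro m hm hSm
        have h2 := bull_right m 0 hSm ha h1 (by omega) (by omega)
        exact claw3 0 2 m ha h2 hSm (by omega) (by omega)
      have h3 : ¬ S 3 := by
        intro h3
        rcases claw1 3 h3 (by omega) (by omega) with h2 | h
        · exact h4 4 le_rfl (bull_right 0 2 ha h2 h3 (by omega) (by omega))
        · exact h4 4 le_rfl h
      by_cases h2 : S 2
      · refine ⟨1, by omega, fun m _ => ⟨fun h => ?_, fun h => ?_⟩⟩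
        · by_contra
          rcases (by omega : m = 3 ∨ 4 ≤ m) with rfl | hm
          · exact h3 h
          · exact h4 m hm h
        · obtain rfl | rfl | rfl : m = 0 ∨ m = 1 ∨ m = 2 := by omega
          all_goals assumption
      · refine ⟨0, by omega, fun m _ => ⟨fun h => ?_, fun h => ?_⟩⟩
        · by_contra
          rcases (by omega : m = 2 ∨ m = 3 ∨ 4 ≤ m) with rfl | rfl | hm
          · exact h2 h
          · exact h3 h
          · exact h4 m hm h
        · obtain rfl | rfl : m = 0 ∨ m = 1 := by omega
          all_goals assumption
    · exfalso
      have hex : ∃ m, S m ∧ m ≠ 0 := by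
        by_contra! hc
        exact h_zero fun m => ⟨hc m, by rintro rfl; exact ha⟩
      obtain ⟨b, ⟨hb, hb0⟩, hbmin⟩ : ∃ b, (S b ∧ b ≠ 0) ∧ ∀ m, m < b → ¬ (S m ∧ m ≠ 0) :=
        ⟨Nat.find hex, Nat.find_spec hex, fun m hm => Nat.find_min hex hm⟩
      have hbn := hS b hb
      have hb1 : b ≠ 1 := by rintro rfl; exact h1 hb
      have hprev : ¬ S (b - 1) := fun h => hbmin (b - 1) (by omega) ⟨h, by omega⟩
      rcases eq_or_lt_of_le hbn with rfl | hlt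
      · refine h_ends fun m => ⟨fun h => ?_, by rintro (rfl | rfl) <;> assumption⟩
        by_contra! hc
        exact hbmin m (by have := hS m h; omega) ⟨h, hc.1⟩
      · have hnext := (claw1 b hb (by omega) (by omega)).resolve_left hprev
        by_cases h2 : b + 2 ≤ n
        · exact claw3 0 b (b + 2) ha hb (bull_right 0 b ha hb hnext h2 (by omega)) (by omega) le_rfl
        · exact hprev (bull_left 0 b ha hb hnext (by omega) (by omega))
  · have hprev := hmin (a - 1) (by omega)
    rcases eq_or_lt_of_le han with rfl | hlt
    · refine absurd (fun m => ⟨fun h => ?_, by rintro rfl; exact ha⟩) h_last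
      by_contra hc
      exact hmin m (by have := hS m h; omega) h
    · have hnext := (claw1 a ha hpos hlt).resolve_left hprev
      by_cases h2 : a + 2 ≤ n
      · have ha2 := (bull1 a ha hnext hpos h2).resolve_left hprev
        refine ⟨a + 1, by omega, fun m _ => ⟨fun h => ?_, fun h => ?_⟩⟩
        · by_contra
          rcases (by omega : m < a ∨ m = a + 3 ∨ a + 4 ≤ m) with hm | rfl | hm
          · exact hmin m hm h
          · exact hprev (bull_left (a + 3) a h ha hnext hpos (by omega))
          · exact claw3 a (a + 2) m ha ha2 h le_rfl (by omega)
        · obtain rfl | rfl | rfl : m = a ∨ m = a + 1 ∨ m = a + 2 := by omega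
          all_goals assumption
      · refine ⟨n, le_rfl, fun m _ => ⟨fun h => ?_, fun h => ?_⟩⟩
        · by_contra
          exact hmin m (by omega) h
        · obtain rfl | rfl : m = a ∨ m = a + 1 := by omega
          all_goals assumption

variable {V : Type*} {G : SimpleGraph V}

theorem exists_longer_path_of_zero {n : ℕ} {c : Fin (n + 1) → V} (hc : IsInducedCopy G (PathRel n) c)
    {w : V} (hw : ∀ m, w ≠ c m) (h : ∀ m, G.Adj w (c m) ↔ (m : ℕ) = 0) :
    IsInducedCopy G (PathRel (n + 1)) (Fin.cons w c : Fin (n + 2) → V) := by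
  have hsym := G.adj_comm
  refine ⟨(Fin.cons_injective_iff).2 ⟨by rintro ⟨m, hm⟩; exact hw m hm.symm, hc.1⟩, ?_⟩
  intro a b
  have hcc := hc.2
  unfold PathRel at *
  refine Fin.cases ?_ (fun a => ?_) a <;> refine Fin.cases ?_ (fun b => ?_) b
  · simp
  · simp [h]
  · simp [hsym _ w, h]
  · intro hab
    have := hcc a b (by grind)
    simpa using this

theorem isInducedCopy_rev {n : ℕ} {c : Fin (n + 1) → V} (hc : IsInducedCopy G (PathRel n) c) :
    IsInducedCopy G (PathRel n) (c ∘ Fin.rev) := by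
  refine ⟨hc.1.comp Fin.rev_injective, fun a b hab => ?_⟩
  have := hc.2 a.rev b.rev (fun h => hab (Fin.rev_injective h))
  rw [Function.comp, Function.comp, this]
  simp only [PathRel, Fin.val_rev]
  omega

theorem exists_longer_path_of_last {n : ℕ} {c : Fin (n + 1) → V}
    (hc : IsInducedCopy G (PathRel n) c) {w : V} (hw : ∀ m, w ≠ c m)
    (h : ∀ m, G.Adj w (c m) ↔ (m : ℕ) = n) :
    ∃ c', IsInducedCopy G (PathRel (n + 1)) c' :=
  ⟨_, exists_longer_path_of_zero (w := w) (isInducedCopy_rev hc) (fun m => hw m.rev) fun m => by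
    rw [Function.comp, h, Fin.val_rev]
    omega⟩

theorem exists_cycle_of_ends {n : ℕ} {c : Fin (n + 1) → V} (hn : 4 ≤ n)
    (hc : IsInducedCopy G (PathRel n) c) {w : V} (hw : ∀ m, w ≠ c m)
    (h : ∀ m, G.Adj w (c m) ↔ (m : ℕ) = 0 ∨ (m : ℕ) = n) :
    ∃ c' : ZMod (n + 2) → V, IsInducedCopy G (StepRel 1) c' := by
  have hsym := G.adj_comm
  have hstep : ∀ a b : Fin (n + 2), StepRel (A := ZMod (n + 2)) 1 a b ↔
      a = b ∨ ((a : ℕ) = b + 1 ∨ (a : ℕ) = 0 ∧ (b : ℕ) = n + 1) ∨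
        ((b : ℕ) = a + 1 ∨ (b : ℕ) = 0 ∧ (a : ℕ) = n + 1) := by
    have hone : ∀ a b : Fin (n + 2), a - b = 1 ↔
        ((a : ℕ) = b + 1 ∨ (a : ℕ) = 0 ∧ (b : ℕ) = n + 1) := by
      intro a b
      rw [sub_eq_iff_eq_add, add_comm 1 b, Fin.ext_iff, Fin.val_add_one]
      split_ifs with hb
      · subst hb
        simp
        omega
      · have : (b : ℕ) ≠ n + 1 := fun h => hb (Fin.ext h)
        omega
    intro a b
    exact or_congr Iff.rfl (or_congr (hone a b) (hone b a))
  refine ⟨(Fin.cons w c : Fin (n + 2) → V),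
    (Fin.cons_injective_iff).2 ⟨by rintro ⟨m, hm⟩; exact hw m hm.symm, hc.1⟩, ?_⟩
  intro a b
  rw [hstep a b]
  have hcc := hc.2
  unfold PathRel at *
  revert a b
  intro (a : Fin (n + 2)) (b : Fin (n + 2))
  refine Fin.cases ?_ (fun a => ?_) a <;> refine Fin.cases ?_ (fun b => ?_) b
  · exact fun h => absurd rfl h
  · intro _
    rw [Fin.cons_zero, Fin.cons_succ, h]
    simp only [Fin.ext_iff, Fin.val_zero, Fin.val_succ, true_and]
    omega
  · intro _
    rw [Fin.cons_zero, Fin.cons_succ, hsym, h]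
    simp only [Fin.ext_iff, Fin.val_zero, Fin.val_succ, true_and]
    omega
  · intro hab
    have := hcc a b (by grind)
    simp only [Fin.cons_succ, this, Fin.val_succ, Fin.ext_iff]
    omega

theorem pathRel_attachesAsTwin (hclaw : ClawFree G) (hbull : BullFree G) {n : ℕ} (hn : 4 ≤ n)
    (hpath : ∀ c : Fin (n + 2) → V, ¬ IsInducedCopy G (PathRel (n + 1)) c)
    (hcycle : ∀ c : ZMod (n + 2) → V, ¬ IsInducedCopy G (StepRel 1) c) :
    AttachesAsTwin G (PathRel n) := by
  rintro c hc w hw ⟨i₀, hi₀⟩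
  obtain ⟨d, hd⟩ : ∃ d : ℕ → V, ∀ i : Fin (n + 1), d i = c i :=
    ⟨fun m => c ⟨min m n, by omega⟩, fun i =>
      congrArg c (Fin.ext (min_eq_left (Nat.le_of_lt_succ i.2)))⟩
  have hs : ∀ i j, j = i + 1 → j ≤ n → G.Adj (d i) (d j) := by
    rintro i j rfl hj
    have := hc.2 ⟨i, by omega⟩ ⟨i + 1, hj.trans_lt (by omega)⟩ (by simp)
    rw [← hd, ← hd] at this
    exact this.2 (by simp [PathRel]; omega)
  have hnon : ∀ i j, i + 2 ≤ j → j ≤ n → d i ≠ d j ∧ ¬ G.Adj (d i) (d j) := by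
    intro i j hij hj
    have := hc.ne_and_not_adj (a := ⟨i, by omega⟩) (b := ⟨j, by omega⟩) (by simp; omega)
      (by simp [PathRel]; omega)
    rwa [← hd, ← hd] at this
  have hwd : ∀ m ≤ n, w ≠ d m := fun m hm => by
    have := hw ⟨m, by omega⟩
    rwa [← hd] at this
  have hsym := G.adj_comm
  have hfin : ∀ p : ℕ → Prop, (∀ m, (m ≤ n ∧ G.Adj w (d m)) ↔ p m) →
      ∀ m : Fin (n + 1), G.Adj w (c m) ↔ p m := by
    intro p h m
    rw [← h, hd]
    exact (and_iff_right (by omega)).symm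
  obtain ⟨j, hj, h⟩ := exists_eq_window (S := fun m => m ≤ n ∧ G.Adj w (d m)) hn
    (fun m h => h.1) ⟨i₀, by omega, by rwa [hd]⟩
    (by
      rintro a ⟨_, ha⟩ h1 h2
      have h := hclaw.exists_adj (v := d a) (hwd (a - 1) (by omega)) (hwd (a + 1) h2)
        (hnon (a - 1) (a + 1) (by omega) h2).1 ha.symm (hs (a - 1) a (by omega) (by omega)).symm
        (hs a (a + 1) rfl h2)
      have := hnon (a - 1) (a + 1) (by omega) h2
      have : a - 1 ≤ n := by omega
      tauto)
    (by
      rintro a b c ⟨_, ha⟩ ⟨_, hb⟩ ⟨_, hc⟩ hab hbc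
      have h1 := hnon a b hab (by omega)
      have h2 := hnon b c hbc (by omega)
      have h3 := hnon a c (by omega) (by omega)
      have := hclaw.exists_adj h1.1 h3.1 h2.1 ha hb hc
      tauto)
    (by
      rintro a ⟨_, ha⟩ ⟨_, hb⟩ h1 h2
      have h := hbull.exists_adj (hwd (a - 1) (by omega)) (hwd (a + 2) h2)
        (hs a (a + 1) rfl (by omega)) hb.symm ha (hs (a - 1) a (by omega) (by omega)).symm
        (hs (a + 1) (a + 2) rfl h2) (hnon (a - 1) (a + 2) (by omega) h2).1
      have := hnon (a - 1) (a + 2) (by omega) h2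
      have := hnon (a - 1) (a + 1) (by omega) (by omega)
      have := hnon a (a + 2) (by omega) h2
      have : a - 1 ≤ n := by omega
      grind)
    (by
      rintro a b ⟨han, ha⟩ ⟨_, hb⟩ ⟨_, hb'⟩ h2 hab
      have hna : ∀ m, b ≤ m → m ≤ b + 2 → d m ≠ d a ∧ ¬ G.Adj (d m) (d a) := by
        intro m h1 h2
        rcases hab with hab | hab
        · have := hnon a m (by omega) (by omega)
          exact ⟨this.1.symm, by rw [hsym]; exact this.2⟩
        · exact hnon m a (by omega) han
      have h := hbull.exists_adj (a := w) (b := d (b + 1)) (c := d b) (d := d a) (e := d (b + 2))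
        (hna b (by omega) (by omega)).1 (hnon b (b + 2) le_rfl h2).1 hb'
        (hs b (b + 1) rfl (by omega)).symm hb.symm ha (hs (b + 1) (b + 2) rfl h2)
        (hna (b + 2) (by omega) le_rfl).1.symm
      have := hna b (by omega) (by omega)
      have := hna (b + 1) (by omega) (by omega)
      have := hna (b + 2) (by omega) le_rfl
      have := hnon b (b + 2) le_rfl h2
      grind)
    (by
      rintro a b ⟨han, ha⟩ ⟨_, hb⟩ ⟨_, hb'⟩ h1 hab
      have hna : ∀ m, b ≤ m + 1 → m ≤ b + 1 → d m ≠ d a ∧ ¬ G.Adj (d m) (d a) := by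
        intro m h1 h2
        rcases hab with hab | hab
        · have := hnon a m (by omega) (by omega)
          exact ⟨this.1.symm, by rw [hsym]; exact this.2⟩
        · exact hnon m a (by omega) han
      have h := hbull.exists_adj (a := w) (b := d b) (c := d (b + 1)) (d := d a) (e := d (b - 1))
        (hna (b + 1) (by omega) (by omega)).1 (hnon (b - 1) (b + 1) (by omega) (by omega)).1.symm hb
        (hs b (b + 1) rfl (by omega)) hb'.symm ha (hs (b - 1) b (by omega) (by omega)).symm
        (hna (b - 1) (by omega) (by omega)).1.symm
      have := hna b (by omega) (by omega)
      have := hna (b + 1) (by omega) (by omega)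
      have := hna (b - 1) (by omega) (by omega)
      have := hnon (b - 1) (b + 1) (by omega) (by omega)
      have : b - 1 ≤ n := by omega
      grind)
    (fun h => hpath _ (exists_longer_path_of_zero hc hw (hfin _ h)))
    (fun h => (exists_longer_path_of_last hc hw (hfin _ h)).elim fun _ => hpath _)
    (fun h => (exists_cycle_of_ends hn hc hw (hfin _ h)).elim fun _ => hcycle _)
  refine ⟨⟨j, by omega⟩, fun m => ?_⟩
  have := h m (by omega)
  rw [hd] at this
  simp only [PathRel]
  rw [← this]
  exact (and_iff_right (by omega)).symm

theorem exists_maximal_inducedPath [Finite V] {n₀ : ℕ}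
    (h : ∃ c, IsInducedCopy G (PathRel n₀) c) :
    ∃ n, n₀ ≤ n ∧ (∃ c, IsInducedCopy G (PathRel n) c) ∧
      ∀ c, ¬ IsInducedCopy G (PathRel (n + 1)) c := by
  by_contra! hno
  have hall : ∀ n, n₀ ≤ n → ∃ c, IsInducedCopy G (PathRel n) c := by
    intro n hn
    induction n, hn using Nat.le_induction with
    | base => exact h
    | succ n hn ih => exact hno n hn ih
  obtain ⟨c, hc⟩ := hall (n₀ + Nat.card V) (by omega)
  have := Nat.card_le_card_of_injective c hc.1
  simp at this

end Path

section FivePath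

variable {V : Type*} {G : SimpleGraph V}

/-- `a b c d e` induce a path in this order. -/
def IsInducedFivePath (G : SimpleGraph V) (a b c d e : V) : Prop :=
  G.Adj a b ∧ G.Adj b c ∧ G.Adj c d ∧ G.Adj d e ∧ a ≠ c ∧ a ≠ d ∧ a ≠ e ∧ b ≠ d ∧ b ≠ e ∧ c ≠ e ∧
    ¬ G.Adj a c ∧ ¬ G.Adj a d ∧ ¬ G.Adj a e ∧ ¬ G.Adj b d ∧ ¬ G.Adj b e ∧ ¬ G.Adj c e

theorem IsInducedFivePath.isInducedCopy {a b c d e : V} (h : IsInducedFivePath G a b c d e) :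
    IsInducedCopy G (PathRel 4) ![a, b, c, d, e] := by
  have hsym := G.adj_comm
  have hne := fun u v => @SimpleGraph.Adj.ne V G u v
  unfold IsInducedFivePath at h
  constructor
  · intro i j
    fin_cases i <;> fin_cases j <;> simp <;> grind
  · intro i j
    fin_cases i <;> fin_cases j <;> simp [PathRel] <;> grind

/-- The vertices `u` and `v` are joined by a walk of length at most three. -/
def WithinThree (G : SimpleGraph V) (u v : V) : Prop :=
  u = v ∨ G.Adj u v ∨ (∃ a, G.Adj u a ∧ G.Adj a v) ∨ ∃ a b, G.Adj u a ∧ G.Adj a b ∧ G.Adj b v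

theorem withinThree_of_no_fivePath (hconn : G.Connected)
    (hno : ∀ a b c d e, ¬ IsInducedFivePath G a b c d e) (u v : V) : WithinThree G u v := by
  have hsym := G.adj_comm
  have step : ∀ v w, G.Adj v w → WithinThree G u v → WithinThree G u w := by
    intro v w hvw h
    by_contra hw
    unfold WithinThree at hw
    push Not at hw
    obtain ⟨h0, h1, h2, h3⟩ := hw
    rcases h with rfl | h | ⟨a, ha, hav⟩ | ⟨a, b, ha, hab, hbv⟩
    · exact h1 hvw
    · exact h2 v h hvw
    · exact h3 a v ha hav hvw
    · refine hno u a b v w ⟨ha, hab, hbv, hvw, ?_, ?_, h0, ?_, ?_, ?_, ?_, ?_, h1, ?_, h2 a ha,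
        h3 a b ha hab⟩
      · rintro rfl; exact h2 v hbv hvw
      · rintro rfl; exact h1 hvw
      · rintro rfl; exact h2 a ha hvw
      · rintro rfl; exact h1 ha
      · rintro rfl; exact h2 a ha hab
      · exact fun h => h3 b v h hbv hvw
      · exact fun h => h2 v h hvw
      · exact fun h => h3 a v ha h hvw
  obtain ⟨p⟩ := hconn.preconnected u v
  have key : ∀ {v w : V} (_ : G.Walk v w), WithinThree G u v → WithinThree G u w := by
    intro v w p
    induction p with
    | nil => exact id
    | cons h _ ih => exact fun hu => ih (step _ _ h hu)
  exact key p (Or.inl rfl)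

theorem not_independent_of_common_neighbour (hclaw : ClawFree G) (hbull : BullFree G)
    (hconn : G.Connected) (hno : ∀ a b c d e, ¬ IsInducedFivePath G a b c d e) {x y z m : V}
    (hxy : x ≠ y) (hxz : x ≠ z) (hyz : y ≠ z) (hmx : G.Adj m x) (hmy : G.Adj m y) :
    G.Adj x y ∨ G.Adj x z ∨ G.Adj y z := by
  have hsym := G.adj_comm
  by_contra! hind
  obtain ⟨nxy, nxz, nyz⟩ := hind
  have claw : ∀ v a b c, a ≠ b → a ≠ c → b ≠ c → G.Adj v a → G.Adj v b → G.Adj v c →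
    G.Adj a b ∨ G.Adj a c ∨ G.Adj b c := fun v a b c => hclaw.exists_adj
  have nmz : ¬ G.Adj m z := fun h => by
    have := claw m x y z hxy hxz hyz hmx hmy h
    tauto
  have hmz : m ≠ z := by rintro rfl; exact nxz hmx.symm
  have no_two : ∀ p, G.Adj z p → ¬ G.Adj p m := by
    intro p hzp hpm
    have h1 := claw m x y p hxy
    have h2 := claw p x y z hxy hxz hyz
    have h3 := hbull.exists_adj (a := p) (b := m) (c := x) (d := z) (e := y)
    have h4 := hbull.exists_adj (a := p) (b := m) (c := y) (d := z) (e := x)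
    have hxp : x ≠ p := by rintro rfl; exact nxz hzp.symm
    have hyp : y ≠ p := by rintro rfl; exact nyz hzp.symm
    by_cases hx : G.Adj p x <;> by_cases hy : G.Adj p y <;> grind
  rcases withinThree_of_no_fivePath hconn hno z m with h | h | ⟨p, hzp, hpm⟩ | ⟨p, q, hzp, hpq, hqm⟩
  · exact hmz h.symm
  · exact nmz h.symm
  · exact no_two p hzp hpm
  · have npm := no_two p hzp
    have nqz : ¬ G.Adj z q := fun h => no_two q h hqm
    have npx : ¬ G.Adj p x ∧ ¬ G.Adj p y := by
      have h2 := claw p x y z hxy hxz hyz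
      have h3 := hno z p x m y
      have h4 := hno z p y m x
      unfold IsInducedFivePath at h3 h4
      grind
    have hclawm := claw m x y q hxy
    have hclawq := claw q x y p hxy
    have h3 := hbull.exists_adj (a := q) (b := m) (c := x) (d := p) (e := y)
    have h4 := hbull.exists_adj (a := q) (b := m) (c := y) (d := p) (e := x)
    have hxp : x ≠ p := by rintro rfl; exact nxz hzp.symm
    have hyp : y ≠ p := by rintro rfl; exact nyz hzp.symm
    have hxq : x ≠ q := by rintro rfl; exact npx.1 hpq
    have hyq : y ≠ q := by rintro rfl; exact npx.2 hpq
    by_cases hx : G.Adj q x <;> by_cases hy : G.Adj q y <;> grind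

theorem adj_of_no_fivePath (hclaw : ClawFree G) (hbull : BullFree G)
    (hconn : G.Connected) (hno : ∀ a b c d e, ¬ IsInducedFivePath G a b c d e) {x y z : V}
    (hxy : x ≠ y) (hxz : x ≠ z) (hyz : y ≠ z) : G.Adj x y ∨ G.Adj x z ∨ G.Adj y z := by
  have hsym := G.adj_comm
  have key : ∀ x y z m, x ≠ y → x ≠ z → y ≠ z → G.Adj m x → G.Adj m y →
      G.Adj x y ∨ G.Adj x z ∨ G.Adj y z := fun x y z m =>
    not_independent_of_common_neighbour hclaw hbull hconn hno
  rcases withinThree_of_no_fivePath hconn hno x y with h | h | ⟨a, h1, h2⟩ | ⟨a, b, h1, h2, h3⟩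
  · exact absurd h hxy
  · exact Or.inl h
  · exact key x y z a hxy hxz hyz h1.symm h2
  · have k1 := key x b z a
    have k2 := key z y x b
    have k3 := key x y z b
    have hxb : x = b → G.Adj x y := by rintro rfl; exact h3
    have hbz : b = z → G.Adj y z := by rintro rfl; exact h3.symm
    by_cases hx : G.Adj b x <;> by_cases hz : G.Adj b z <;> grind

end FivePath

/-- Structure theorem: every connected (claw, bull)-free graph is an expansion of a path of
length at least 4, an expansion of a cycle of length at least 6, or has independence number
at most 2 (i.e., is the complement of a triangle-free graph). -/
theorem structure_clawFree_bullFree {V : Type*} [Fintype V] [Nonempty V]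
    (G : SimpleGraph V) (hconn : G.Connected)
    (hclaw : ClawFree G) (hbull : BullFree G) :
    (∃ n : ℕ, 4 ≤ n ∧ IsPathExpansion G n) ∨
    (∃ k : ℕ, 6 ≤ k ∧ IsCycleExpansion G k) ∨
    (∀ x y z : V, x ≠ y → x ≠ z → y ≠ z → G.Adj x y ∨ G.Adj x z ∨ G.Adj y z) := by
  by_cases hno : ∀ a b c d e, ¬ IsInducedFivePath G a b c d e
  · exact Or.inr (Or.inr fun x y z => adj_of_no_fivePath hclaw hbull hconn hno)
  push Not at hno
  obtain ⟨a, b, c, d, e, h⟩ := hno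
  obtain ⟨n, hn, ⟨p, hp⟩, hmax⟩ := exists_maximal_inducedPath ⟨_, h.isInducedCopy⟩
  by_cases hcycle : ∃ c : ZMod (n + 2) → V, IsInducedCopy G (StepRel 1) c
  · obtain ⟨c, hc⟩ := hcycle
    exact Or.inr (Or.inl ⟨n + 2, by omega,
      isCycleExpansion_of_isInducedCopy hconn hclaw hbull (by omega) hc⟩)
  · push Not at hcycle
    exact Or.inl ⟨n, hn, exists_expansion hconn hp pathRel_symm (pathRel_exists_ne hn)
      (pathRel_determines_or hn) (pathRel_attachesAsTwin hclaw hbull hn hmax hcycle) 0⟩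
end

section
/- A finite graph H is triangle-free if and only if H is complete bipartite, or the complement of H is a connected claw-free and bull-free graph that is neither an expansion of a path of length at least 4 nor an expansion of a cycle of length at least 6. -/
/-- `H` is complete bipartite: the vertices split into two parts such that two vertices are
adjacent iff they lie in different parts. -/
def IsCompleteBipartite {V : Type*} (H : SimpleGraph V) : Prop :=
  ∃ A : Set V, ∀ x y : V,
    H.Adj x y ↔ ((x ∈ A ∧ y ∉ A) ∨ (x ∉ A ∧ y ∈ A))

namespace SimpleGraph

variable {V I : Type*} {G : SimpleGraph V} {A : SimpleGraph I}

theorem ClawFree.false_of_adj (h : ClawFree G) {v a b c : V} (hab : a ≠ b) (hac : a ≠ c)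
    (hbc : b ≠ c) (va : G.Adj v a) (vb : G.Adj v b) (vc : G.Adj v c) (nab : ¬ G.Adj a b)
    (nac : ¬ G.Adj a c) (nbc : ¬ G.Adj b c) : False :=
  h ⟨v, a, b, c, hab, hac, hbc, va, vb, vc, nab, nac, nbc⟩

theorem BullFree.false_of_adj (h : BullFree G) {a b c d e : V} (hcd : c ≠ d) (hce : c ≠ e)
    (hde : d ≠ e) (ab : G.Adj a b) (bc : G.Adj b c) (ca : G.Adj c a) (ad : G.Adj a d)
    (be : G.Adj b e) (nbd : ¬ G.Adj b d) (ncd : ¬ G.Adj c d) (nae : ¬ G.Adj a e)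
    (nce : ¬ G.Adj c e) (nde : ¬ G.Adj d e) : False :=
  h ⟨a, b, c, d, e, fun h => nce (h ▸ ca), fun h => ncd (h ▸ bc.symm), hcd, hce, hde,
    ab, bc, ca, ad, be, nbd, ncd, nae, nce, nde⟩

theorem Connected.induction_on_adj (hG : G.Connected) {P : V → Prop} {a : V} (ha : P a)
    (step : ∀ v w, P v → G.Adj v w → P w) (b : V) : P b := by
  obtain ⟨w⟩ := hG.preconnected a b
  induction w with
  | nil => exact ha
  | cons h _ ih => exact ih (step _ _ ha h)

/-! ### Induced copies and the trace of an outer vertex -/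

section Trace

variable (p : A ↪g G) {v : V}

theorem ClawFree.adj_or_adj (hc : ClawFree G) (hv : ∀ i, p i ≠ v) {i a b : I} (hi : G.Adj v (p i))
    (ia : A.Adj i a) (ib : A.Adj i b) (hab : a ≠ b) (nab : ¬ A.Adj a b) :
    G.Adj v (p a) ∨ G.Adj v (p b) := by
  by_contra! h
  exact ClawFree.false_of_adj hc (hv a).symm (hv b).symm (p.injective.ne hab) hi.symm
    (p.map_adj_iff.2 ia) (p.map_adj_iff.2 ib) h.1 h.2 (mt p.map_adj_iff.1 nab)

theorem ClawFree.not_three_adj (hc : ClawFree G) {i j k : I} (hi : G.Adj v (p i))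
    (hj : G.Adj v (p j)) (hk : G.Adj v (p k)) (hij : i ≠ j) (hik : i ≠ k) (hjk : j ≠ k)
    (nij : ¬ A.Adj i j) (nik : ¬ A.Adj i k) (njk : ¬ A.Adj j k) : False :=
  ClawFree.false_of_adj hc (p.injective.ne hij) (p.injective.ne hik) (p.injective.ne hjk) hi hj hk
    (mt p.map_adj_iff.1 nij) (mt p.map_adj_iff.1 nik) (mt p.map_adj_iff.1 njk)

theorem BullFree.adj_or_adj (hb : BullFree G) (hv : ∀ i, p i ≠ v) {a i j b : I}
    (hi : G.Adj v (p i)) (hj : G.Adj v (p j)) (ia : A.Adj i a) (ij : A.Adj i j) (jb : A.Adj j b)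
    (hab : a ≠ b) (nja : ¬ A.Adj j a) (nib : ¬ A.Adj i b) (nab : ¬ A.Adj a b) :
    G.Adj v (p a) ∨ G.Adj v (p b) := by
  by_contra! h
  exact BullFree.false_of_adj hb (hv a).symm (hv b).symm (p.injective.ne hab)
    (p.map_adj_iff.2 ij) hj.symm hi (p.map_adj_iff.2 ia) (p.map_adj_iff.2 jb)
    (mt p.map_adj_iff.1 nja) h.1 (mt p.map_adj_iff.1 nib) h.2 (mt p.map_adj_iff.1 nab)

theorem BullFree.adj_of_adj (hb : BullFree G) {i j b k : I} (hi : G.Adj v (p i))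
    (hj : G.Adj v (p j)) (hk : G.Adj v (p k)) (ij : A.Adj i j) (jb : A.Adj j b)
    (hib : i ≠ b) (hik : i ≠ k) (hbk : b ≠ k) (nib : ¬ A.Adj i b) (nik : ¬ A.Adj i k)
    (njk : ¬ A.Adj j k) (nkb : ¬ A.Adj k b) : G.Adj v (p b) := by
  by_contra h
  exact BullFree.false_of_adj hb (p.injective.ne hik) (p.injective.ne hib) (p.injective.ne hbk.symm)
    hj (p.map_adj_iff.2 ij.symm) hi.symm hk (p.map_adj_iff.2 jb) (mt p.map_adj_iff.1 njk)
    (mt p.map_adj_iff.1 nik) h (mt p.map_adj_iff.1 nib) (mt p.map_adj_iff.1 nkb)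

/-- Replacing the image of `i` by an outer vertex `v` with the same closed neighbourhood. -/
theorem exists_embedding_replace [DecidableEq I] (hv : ∀ i, p i ≠ v) {i : I}
    (ht : ∀ j, G.Adj v (p j) ↔ j = i ∨ A.Adj i j) :
    ∃ q : A ↪g G, q i = v ∧ ∀ j, j ≠ i → q j = p j := by
  refine ⟨⟨⟨Function.update p i v, ?_⟩, ?_⟩, ?_, ?_⟩
  · intro a b hab
    by_cases ha : a = i <;> by_cases hb : b = i <;>
      simp only [ha, hb, Function.update_self, Function.update_of_ne, ne_eq, not_false_eq_true]
        at hab ⊢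
    · exact absurd hab.symm (hv b)
    · exact absurd hab (hv a)
    · exact p.injective hab
  · intro a b
    change G.Adj (Function.update p i v a) (Function.update p i v b) ↔ _
    by_cases ha : a = i <;> by_cases hb : b = i
    · subst ha; subst hb; simp
    · subst ha; simp [hb, ht]
    · subst hb; simp [ha, G.adj_comm _ v, ht, A.adj_comm]
    · simp [ha, hb]
  · exact Function.update_self ..
  · intro j hj
    exact Function.update_of_ne hj ..

end Trace

/-- If every vertex attached to an induced copy of `A` has the trace of a vertex of `A`, then `G`
is an expansion of `A`. -/
theorem exists_expansion_map [DecidableEq I] (hG : G.Connected) (p : A ↪g G) [Nonempty I]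
    (htrace : ∀ (q : A ↪g G) (v : V), (∀ i, q i ≠ v) → (∃ i, G.Adj v (q i)) →
      ∃ i, ∀ j, G.Adj v (q j) ↔ j = i ∨ A.Adj i j)
    (hdeg : ∀ i, ∃ j, A.Adj i j)
    (hsep : ∀ i j, (∀ i', (∀ l, l ≠ j → ((l = i ∨ A.Adj i l) ↔ (l = i' ∨ A.Adj i' l))) →
        ((j = i ∨ A.Adj i j) ↔ (j = i' ∨ A.Adj i' j))) ∨
      (∀ j', (∀ l, l ≠ i → ((l = j ∨ A.Adj j l) ↔ (l = j' ∨ A.Adj j' l))) →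
        ((i = j ∨ A.Adj j i) ↔ (i = j' ∨ A.Adj j' i)))) :
    ∃ f : V → I, Function.Surjective f ∧
      ∀ x y : V, x ≠ y → (G.Adj x y ↔ f x = f y ∨ A.Adj (f x) (f y)) := by
  have hall : ∀ v, ∃ i, p i = v ∨
      ((∀ j, p j ≠ v) ∧ ∀ j, G.Adj v (p j) ↔ j = i ∨ A.Adj i j) := by
    refine hG.induction_on_adj (a := p (Classical.arbitrary I)) ⟨_, .inl rfl⟩ ?_
    rintro v w ⟨i, hi⟩ hvw
    by_cases hw : ∃ j, p j = w
    · exact hw.imp fun _ => .inl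
    push Not at hw
    suffices ∃ j, G.Adj w (p j) by
      obtain ⟨j, hj⟩ := htrace p w hw this
      exact ⟨j, .inr ⟨hw, hj⟩⟩
    rcases hi with rfl | ⟨hv, ht⟩
    · exact ⟨i, hvw.symm⟩
    by_contra! hno
    obtain ⟨q, hqi, hq⟩ := exists_embedding_replace p hv ht
    have hqw : ∀ j, q j ≠ w := by
      intro j
      by_cases h : j = i
      · rw [h, hqi]; exact hvw.ne
      · rw [hq j h]; exact hw j
    obtain ⟨k, hk⟩ := htrace q w hqw ⟨i, by rw [hqi]; exact hvw.symm⟩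
    have key : ∀ j, G.Adj w (q j) → j = i := by
      intro j hj
      by_contra h
      rw [hq j h] at hj
      exact hno j hj
    obtain ⟨l, hl⟩ := hdeg k
    have h1 := key k ((hk k).2 (.inl rfl))
    have h2 := key l ((hk l).2 (.inr hl))
    exact hl.ne (h1.trans h2.symm)
  have hpair : ∀ x y i j, x ≠ y → (∀ k, p k ≠ x) → (∀ k, p k ≠ y) →
      (∀ k, G.Adj x (p k) ↔ k = i ∨ A.Adj i k) → (∀ k, G.Adj y (p k) ↔ k = j ∨ A.Adj j k) →
      (∀ i', (∀ l, l ≠ j → ((l = i ∨ A.Adj i l) ↔ (l = i' ∨ A.Adj i' l))) →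
        ((j = i ∨ A.Adj i j) ↔ (j = i' ∨ A.Adj i' j))) →
      (G.Adj x y ↔ j = i ∨ A.Adj i j) := by
    intro x y i j hxy hx hy hxt hyt hgood
    obtain ⟨q, hqj, hq⟩ := exists_embedding_replace p hy hyt
    have hqx : ∀ k, q k ≠ x := by
      intro k
      by_cases h : k = j
      · rw [h, hqj]; exact hxy.symm
      · rw [hq k h]; exact hx k
    have hne : ∃ k, G.Adj x (q k) := by
      obtain ⟨l, hl⟩ := hdeg i
      by_cases h : i = j
      · exact ⟨l, by rw [hq l (h ▸ hl.ne'), hxt]; exact .inr hl⟩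
      · exact ⟨i, by rw [hq i h, hxt]; exact .inl rfl⟩
    obtain ⟨i', hi'⟩ := htrace q x hqx hne
    rw [← hqj, hi', hgood i']
    intro l hl
    rw [← hi', hq l hl, hxt]
  choose f hf using hall
  have hfp : ∀ i, f (p i) = i := fun i => by
    rcases hf (p i) with h | h
    · exact p.injective h
    · exact absurd rfl (h.1 i)
  refine ⟨f, fun i => ⟨p i, hfp i⟩, fun x y hxy => ?_⟩
  rcases hf x with hx | ⟨hx, hxt⟩ <;> rcases hf y with hy | ⟨hy, hyt⟩
  · have : f x ≠ f y := fun h => hxy (by rw [← hx, ← hy, h])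
    conv_lhs => rw [← hx, ← hy]
    simp [this]
  · conv_lhs => rw [← hx, G.adj_comm, hyt]
    rw [A.adj_comm]
  · conv_lhs => rw [← hy, hxt]
    rw [eq_comm]
  · rcases hsep (f x) (f y) with h | h
    · rw [hpair x y _ _ hxy hx hy hxt hyt h, eq_comm]
    · rw [G.adj_comm, hpair y x _ _ hxy.symm hy hx hyt hxt h, A.adj_comm]

/-! ### Cycles -/

theorem zmod_small_ne_zero {k : ℕ} (hk : 6 ≤ k) :
    (1 : ZMod k) ≠ 0 ∧ (2 : ZMod k) ≠ 0 ∧ (3 : ZMod k) ≠ 0 ∧ (4 : ZMod k) ≠ 0 ∧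
      (5 : ZMod k) ≠ 0 := by
  have key : ∀ m : ℕ, 0 < m → m < 6 → (m : ZMod k) ≠ 0 := by
    intro m hm hm6
    rw [Ne, ZMod.natCast_eq_zero_iff]
    exact Nat.not_dvd_of_pos_of_lt hm (by omega)
  refine ⟨?_, ?_, ?_, ?_, ?_⟩
  · simpa using key 1
  · simpa using key 2
  · simpa using key 3
  · simpa using key 4
  · simpa using key 5

/-- The possible traces of an outer vertex on an induced cycle. The generator `u` is `1` in the
application. -/
theorem exists_cycle_trace_center {k : ℕ} {u : ZMod k} {N : ZMod k → Prop} (hne : ∃ i, N i)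
    (C : ∀ i, N i → N (i - u) ∨ N (i + u))
    (S : ∀ i l, N (i - u) → N (i + u) → l ≠ i - 2 * u → l ≠ i - u → l ≠ i → l ≠ i + u →
      l ≠ i + 2 * u → ¬ N l)
    (B : ∀ i, N i → N (i + u) → N (i - u) ∨ N (i + 2 * u))
    (B₁ : ∀ i, N (i - u) → N (i + u) → N (i + 2 * u) → N (i + 3 * u))
    (B₂ : ∀ i, N (i - u) → N (i + u) → N (i - 2 * u) → N (i - 3 * u))
    (h1 : u ≠ 0) (h2 : 2 * u ≠ 0) (h3 : 3 * u ≠ 0) (h4 : 4 * u ≠ 0) (h5 : 5 * u ≠ 0) :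
    ∃ i, ∀ l, N l ↔ l = i ∨ (i - l = u ∨ l - i = u) := by
  obtain ⟨i, hi⟩ := hne
  obtain ⟨j, hj, hj'⟩ : ∃ j, N j ∧ N (j + u) := by
    rcases C i hi with h | h
    · exact ⟨i - u, h, by simpa using hi⟩
    · exact ⟨i, hi, h⟩
  obtain ⟨j, ha, hj, hb⟩ : ∃ j, N (j - u) ∧ N j ∧ N (j + u) := by
    rcases B j hj hj' with h | h
    · exact ⟨j, h, hj, hj'⟩
    · exact ⟨j + u, by simpa using hj, hj', by convert h using 1; ring⟩
  have S' := fun l => S j l ha hb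
  have B₁' := B₁ j ha hb
  have B₂' := B₂ j ha hb
  clear C S B B₁ B₂
  have n2 : ¬ N (j + 2 * u) := fun h =>
    S' (j + 3 * u) (by grind) (by grind) (by grind) (by grind) (by grind) (B₁' h)
  have n2' : ¬ N (j - 2 * u) := fun h =>
    S' (j - 3 * u) (by grind) (by grind) (by grind) (by grind) (by grind) (B₂' h)
  clear B₁' B₂'
  refine ⟨j, fun l => ⟨fun hl => ?_, fun hl => ?_⟩⟩
  · by_contra hlj
    exact S' l (by grind) (by grind) (by grind) (by grind) (by grind) hl
  · clear S'
    grind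

theorem isCycleExpansion_of_embedding (hG : G.Connected) (hc : ClawFree G) (hb : BullFree G)
    {k : ℕ} (hk : 6 ≤ k) (p : circulantGraph ({1} : Set (ZMod k)) ↪g G) :
    IsCycleExpansion G k := by
  have hA' : ∀ i j : ZMod k, (circulantGraph ({1} : Set (ZMod k))).Adj i j ↔
      i - j = 1 ∨ j - i = 1 := by
    intro i j
    simp only [circulantGraph_adj, Set.mem_singleton_iff]
    have := (zmod_small_ne_zero hk).1
    grind
  -- `grind` handles multiples of an opaque generator better than numerals of `ZMod k`
  obtain ⟨u, hA, h1, h2, h3, h4, h5⟩ : ∃ u : ZMod k,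
      (∀ i j : ZMod k, (circulantGraph ({1} : Set (ZMod k))).Adj i j ↔ i - j = u ∨ j - i = u) ∧
      u ≠ 0 ∧ 2 * u ≠ 0 ∧ 3 * u ≠ 0 ∧ 4 * u ≠ 0 ∧ 5 * u ≠ 0 :=
    ⟨1, hA', by simpa only [mul_one] using zmod_small_ne_zero hk⟩
  refine (exists_expansion_map hG p ?_ ?_ ?_).imp
    fun f hf => ⟨hf.1, fun x y hxy => by rw [hf.2 x y hxy, hA']⟩
  · rintro q v hv hne
    clear hA'
    simp only [hA]
    refine exists_cycle_trace_center (N := fun j => G.Adj v (q j)) hne (fun i hi => ?_)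
      (fun i l ha hb' n1 n2 n3 n4 n5 hl => ?_) (fun i hi hi' => ?_) (fun i ha hb' h => ?_)
      (fun i ha hb' h => ?_) h1 h2 h3 h4 h5
    · refine ClawFree.adj_or_adj q hc hv hi ?_ ?_ ?_ ?_ <;> grind
    · refine ClawFree.not_three_adj q hc ha hb' hl ?_ ?_ ?_ ?_ ?_ ?_ <;> grind
    · refine BullFree.adj_or_adj q hb hv hi hi' ?_ ?_ ?_ ?_ ?_ ?_ ?_ <;> grind
    · refine BullFree.adj_of_adj q hb hb' h ha ?_ ?_ ?_ ?_ ?_ ?_ ?_ ?_ ?_ <;> grind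
    · refine BullFree.adj_of_adj q hb ha h hb' ?_ ?_ ?_ ?_ ?_ ?_ ?_ ?_ ?_ <;> grind
  · exact fun i => ⟨i + u, by rw [hA]; grind⟩
  · intro i j
    left
    intro i' h
    simp only [hA] at h ⊢
    suffices i = i' by rw [this]
    have e1 := fun hj => (h i hj).1 (by simp)
    have e2 := fun hj => (h (i - u) hj).1 (by simp)
    have e3 := fun hj => (h (i + u) hj).1 (by simp)
    have e4 := fun hj => (h (i - 2 * u) hj).2
    have e5 := fun hj => (h (i + 2 * u) hj).2
    clear h hA hA'
    grind +splitImp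

/-! ### Paths -/

/-- The possible traces of an outer vertex on a longest induced path with `n + 1` vertices. -/
theorem exists_trace_center {n : ℕ} (hn : 4 ≤ n) {N : ℕ → Prop} (hne : ∃ i ≤ n, N i)
    (C : ∀ i, i + 2 ≤ n → N (i + 1) → N i ∨ N (i + 2))
    (S : ∀ i j k, k ≤ n → i + 2 ≤ j → j + 2 ≤ k → N i → N j → N k → False)
    (B : ∀ i, i + 3 ≤ n → N (i + 1) → N (i + 2) → N i ∨ N (i + 3))
    (B₁ : ∀ j k, j + 2 ≤ n → k ≤ n → N j → N (j + 1) → N k → k + 2 ≤ j ∨ j + 4 ≤ k → N (j + 2))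
    (B₂ : ∀ j k, j + 2 ≤ n → k ≤ n → N (j + 1) → N (j + 2) → N k → k + 2 ≤ j ∨ j + 4 ≤ k → N j)
    (E₀ : N 0 → ∃ j ≤ n, j ≠ 0 ∧ N j) (E₁ : N n → ∃ j ≤ n, j ≠ n ∧ N j)
    (E₂ : N 0 → N n → ∃ j ≤ n, j ≠ 0 ∧ j ≠ n ∧ N j) :
    ∃ i ≤ n, ∀ j ≤ n, N j ↔ j ≤ i + 1 ∧ i ≤ j + 1 := by
  classical
  obtain ⟨m, ⟨hmn, hm⟩, hmin⟩ : ∃ m, (m ≤ n ∧ N m) ∧ ∀ j < m, ¬ (j ≤ n ∧ N j) :=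
    ⟨Nat.find hne, Nat.find_spec hne, fun j hj => Nat.find_min hne hj⟩
  rcases Nat.eq_zero_or_pos m with rfl | hpos
  · by_cases h1 : N 1
    · by_cases h2 : N 2
      · have h3 : ¬ N 3 := by
          intro h3
          have := B₁ 2 0 (by omega) (by omega) h2 h3 hm (by omega)
          exact S 0 2 4 (by omega) (by omega) (by omega) hm h2 this
        refine ⟨1, by omega, fun j hj => ⟨fun h => ⟨?_, by omega⟩, fun h => ?_⟩⟩
        · by_contra hj'
          obtain rfl | h4 : j = 3 ∨ 4 ≤ j := by omega
          · exact h3 h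
          · exact S 0 2 j (by omega) (by omega) (by omega) hm h2 h
        · obtain rfl | rfl | rfl : j = 0 ∨ j = 1 ∨ j = 2 := by omega
          all_goals assumption
      · have h4 : ∀ j ≤ n, 4 ≤ j → ¬ N j := fun j hj h4 h =>
          h2 (B₁ 0 j (by omega) hj hm h1 h (by omega))
        refine ⟨0, by omega, fun j hj => ⟨fun h => ⟨?_, by omega⟩, fun h => ?_⟩⟩
        · by_contra hj'
          obtain rfl | rfl | h5 : j = 2 ∨ j = 3 ∨ 4 ≤ j := by omega
          · exact h2 h
          · rcases C 2 (by omega) h with h | h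
            · exact h2 h
            · exact h4 4 (by omega) le_rfl h
          · exact h4 j hj h5 h
        · obtain rfl | rfl : j = 0 ∨ j = 1 := by omega
          all_goals assumption
    · exfalso
      have hpair : ∀ j, 2 ≤ j → j + 1 ≤ n → N j → N (j + 1) → False := by
        intro j hj hjn h h'
        obtain rfl | h3 : j = 2 ∨ 3 ≤ j := by omega
        · have := B₁ 2 0 (by omega) (by omega) h h' hm (by omega)
          exact S 0 2 4 (by omega) (by omega) (by omega) hm h this
        · obtain ⟨j, rfl⟩ := Nat.exists_eq_add_of_le' h3
          have := B₂ (j + 2) 0 (by omega) (by omega) h h' hm (by omega)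
          exact S 0 (j + 2) (j + 4) (by omega) (by omega) (by omega) hm this h'
      have hint : ∀ j, j < n → j ≠ 0 → ¬ N j := by
        intro j hj h0 h
        obtain ⟨i, rfl⟩ := Nat.exists_eq_succ_of_ne_zero h0
        rcases Nat.eq_zero_or_pos i with rfl | hi
        · exact h1 h
        rcases C i (by omega) h with h' | h'
        · obtain rfl | hi2 : i = 1 ∨ 2 ≤ i := by omega
          · exact h1 h'
          · exact hpair i hi2 (by omega) h' h
        · exact hpair (i + 1) (by omega) (by omega) h h'
      obtain ⟨j, hj, hj0, h⟩ := E₀ hm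
      have : j = n := by
        by_contra hjn
        exact hint j (by omega) hj0 h
      subst this
      obtain ⟨l, hl, hl0, hln, h'⟩ := E₂ hm h
      exact hint l (by omega) hl0 h'
  · obtain ⟨i, rfl⟩ := Nat.exists_eq_succ_of_ne_zero hpos.ne'
    have hi : ¬ N i := fun h => hmin i (by omega) ⟨by omega, h⟩
    have hlt : i + 1 < n := by
      by_contra hlt
      obtain rfl : n = i + 1 := by omega
      obtain ⟨j, hj, hjn, h⟩ := E₁ hm
      exact hmin j (by omega) ⟨hj, h⟩
    have h2 : N (i + 2) := (C i (by omega) hm).resolve_left hi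
    have hlow : ∀ j ≤ n, N j → i + 1 ≤ j := fun j hj h => by
      by_contra h'
      exact hmin j (by omega) ⟨hj, h⟩
    refine ⟨i + 2, by omega, fun j hj => ⟨fun h => ⟨?_, ?_⟩, fun h => ?_⟩⟩
    · by_contra hj'
      exact hi (B₂ i j (by omega) hj hm h2 h (by omega))
    · have := hlow j hj h
      omega
    · obtain rfl | rfl | rfl : j = i + 1 ∨ j = i + 2 ∨ j = i + 3 := by omega
      · exact hm
      · exact h2
      · exact (B i (by omega) hm h2).resolve_left hi

/-- A vertex whose trace on an induced path is its first vertex extends that path. -/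
theorem nonempty_pathGraph_embedding_succ {n : ℕ} (p : pathGraph (n + 1) ↪g G) {v : V}
    (hv : ∀ i, p i ≠ v) (ht : ∀ i, G.Adj v (p i) ↔ i = 0) :
    Nonempty (pathGraph (n + 2) ↪g G) := by
  refine ⟨⟨⟨Fin.cons v p, Fin.cons_injective_iff.2 ⟨fun ⟨i, hi⟩ => hv i hi, p.injective⟩⟩, ?_⟩⟩
  intro a b
  change G.Adj ((Fin.cons v p : Fin (n + 2) → V) a) ((Fin.cons v p : Fin (n + 2) → V) b) ↔ _
  rw [pathGraph_adj]
  refine Fin.cases ?_ (fun a => ?_) a <;> refine Fin.cases ?_ (fun b => ?_) b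
  · simp
  · simp only [Fin.cons_zero, Fin.cons_succ, ht, Fin.ext_iff, Fin.val_zero, Fin.val_succ]
    omega
  · simp only [Fin.cons_zero, Fin.cons_succ, G.adj_comm _ v, ht, Fin.ext_iff, Fin.val_zero,
      Fin.val_succ]
    omega
  · simp only [Fin.cons_succ, p.map_adj_iff, pathGraph_adj, Fin.val_succ]
    omega

theorem fin_sub_eq_one_iff {n : ℕ} (a b : Fin (n + 2)) :
    a - b = 1 ↔ (a : ℕ) = b + 1 ∨ ((a : ℕ) = 0 ∧ (b : ℕ) = n + 1) := by
  rw [sub_eq_iff_eq_add', Fin.ext_iff, Fin.val_add_one]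
  have := a.isLt
  have := b.isLt
  split_ifs with h
  · simp only [Fin.ext_iff, Fin.val_last] at h
    omega
  · simp only [Fin.ext_iff, Fin.val_last] at h
    omega

/-- A vertex whose trace on an induced path consists of its two ends closes a cycle. -/
theorem nonempty_cycle_embedding {n : ℕ} (hn : 1 ≤ n) (p : pathGraph (n + 1) ↪g G) {v : V}
    (hv : ∀ i, p i ≠ v) (ht : ∀ i, G.Adj v (p i) ↔ i = 0 ∨ i = Fin.last n) :
    Nonempty (circulantGraph ({1} : Set (ZMod (n + 2))) ↪g G) := by
  refine ⟨⟨⟨(Fin.cons v p : Fin (n + 2) → V),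
    Fin.cons_injective_iff.2 ⟨fun ⟨i, hi⟩ => hv i hi, p.injective⟩⟩, ?_⟩⟩
  intro (a : Fin (n + 2)) (b : Fin (n + 2))
  change G.Adj ((Fin.cons v p : Fin (n + 2) → V) a) ((Fin.cons v p : Fin (n + 2) → V) b) ↔
    a ≠ b ∧ (a - b = 1 ∨ b - a = 1)
  rw [fin_sub_eq_one_iff, fin_sub_eq_one_iff, Ne, Fin.ext_iff]
  refine Fin.cases ?_ (fun a => ?_) a <;> refine Fin.cases ?_ (fun b => ?_) b
  · simp
  · simp only [Fin.cons_zero, Fin.cons_succ, ht, Fin.ext_iff, Fin.val_zero, Fin.val_succ,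
      Fin.val_last, true_and]
    omega
  · simp only [Fin.cons_zero, Fin.cons_succ, G.adj_comm _ v, ht, Fin.ext_iff, Fin.val_zero,
      Fin.val_succ, Fin.val_last, true_and]
    omega
  · simp only [Fin.cons_succ, p.map_adj_iff, pathGraph_adj, Fin.val_succ]
    omega

/-- The reversal of the path graph. -/
def pathGraphRev (n : ℕ) : pathGraph n ↪g pathGraph n where
  toFun := Fin.rev
  inj' := Fin.rev_injective
  map_rel_iff' := by
    intro a b
    simp only [Function.Embedding.coeFn_mk, pathGraph_adj, Fin.val_rev]
    omega

/-- Closed neighbourhoods in a path which agree outside `j` are equal, apart from two exceptions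
near the ends. -/
theorem interval_trace_separation {n i i' j : ℕ} (hn : 4 ≤ n) (hi : i < n + 1) (hi' : i' < n + 1)
    (hj : j < n + 1) (hij : ¬ ((i ≤ 1 ∧ j = 2) ∨ (n ≤ i + 1 ∧ j + 2 = n)))
    (h : ∀ l < n + 1, ¬ l = j →
      ((l = i ∨ i + 1 = l ∨ l + 1 = i) ↔ (l = i' ∨ i' + 1 = l ∨ l + 1 = i'))) :
    (j = i ∨ i + 1 = j ∨ j + 1 = i) ↔ (j = i' ∨ i' + 1 = j ∨ j + 1 = i') := by
  have e1 := h (i - 1)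
  have e2 := h i
  have e3 := h (i + 1)
  have e4 := h (i' - 1)
  have e5 := h i'
  have e6 := h (i' + 1)
  clear h
  obtain h | h | h | h | h : i' = i ∨ i' = i + 1 ∨ i = i' + 1 ∨ i + 2 ≤ i' ∨ i' + 2 ≤ i := by omega
  all_goals omega

theorem isPathExpansion_of_embedding (hG : G.Connected) (hc : ClawFree G) (hb : BullFree G)
    {n : ℕ} (hn : 4 ≤ n) (p : pathGraph (n + 1) ↪g G)
    (hmax : IsEmpty (pathGraph (n + 2) ↪g G))
    (hcyc : IsEmpty (circulantGraph ({1} : Set (ZMod (n + 2))) ↪g G)) :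
    IsPathExpansion G n := by
  refine (exists_expansion_map hG p ?_ ?_ ?_).imp fun f hf => ⟨hf.1, fun x y hxy => by
    rw [hf.2 x y hxy, pathGraph_adj, Fin.ext_iff]
    omega⟩
  · rintro q v hv ⟨i₀, hi₀⟩
    have E₀ : G.Adj v (q 0) → ∃ j, j ≠ 0 ∧ G.Adj v (q j) := by
      intro h
      by_contra! h'
      obtain ⟨r⟩ := nonempty_pathGraph_embedding_succ q hv
        (fun i => ⟨fun hi => by_contra fun h0 => h' i h0 hi, fun h0 => h0 ▸ h⟩)
      exact hmax.false r
    have E₁ : G.Adj v (q (Fin.last n)) → ∃ j, j ≠ Fin.last n ∧ G.Adj v (q j) := by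
      intro h
      by_contra! h'
      obtain ⟨r⟩ := nonempty_pathGraph_embedding_succ (q.comp (pathGraphRev (n + 1)))
        (fun i => hv _) (fun i => by
          change G.Adj v (q i.rev) ↔ _
          refine ⟨fun hi => by_contra fun h0 => h' _ ?_ hi, ?_⟩
          · simpa [Fin.rev_eq_iff] using h0
          · rintro rfl
            simpa using h)
      exact hmax.false r
    have E₂ : G.Adj v (q 0) → G.Adj v (q (Fin.last n)) →
        ∃ j, j ≠ 0 ∧ j ≠ Fin.last n ∧ G.Adj v (q j) := by
      intro h0 hl
      by_contra! h'
      obtain ⟨r⟩ := nonempty_cycle_embedding (by omega) q hv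
        (fun i => ⟨fun hi => by
          by_contra! h
          exact h' i h.1 h.2 hi, by rintro (rfl | rfl) <;> assumption⟩)
      exact hcyc.false r
    have C := fun a i b => ClawFree.adj_or_adj q hc hv (i := i) (a := a) (b := b)
    have S := fun i j k => ClawFree.not_three_adj q hc (v := v) (i := i) (j := j) (k := k)
    have B := fun a i j b => BullFree.adj_or_adj q hb hv (a := a) (i := i) (j := j) (b := b)
    have B' := fun i j b k => BullFree.adj_of_adj q hb (v := v) (i := i) (j := j) (b := b) (k := k)
    simp only [pathGraph_adj, Ne, Fin.ext_iff] at C S B B' E₀ E₁ E₂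
    obtain ⟨N, hN⟩ : ∃ N : ℕ → Prop, ∀ j : Fin (n + 1), G.Adj v (q j) ↔ N j :=
      ⟨fun j => ∃ h : j < n + 1, G.Adj v (q ⟨j, h⟩), fun j => ⟨fun h => ⟨j.2, h⟩, fun h => h.2⟩⟩
    simp only [hN, Fin.forall_iff, Fin.exists_iff, Fin.val_zero, Fin.val_last]
      at C S B B' E₀ E₁ E₂ hi₀ ⊢
    obtain ⟨i, hi, h⟩ := exists_trace_center hn (N := N) ⟨i₀, by omega, hi₀⟩
      (fun i _ h => C i (by omega) (i + 1) (by omega) (i + 2) (by omega) h (by omega) (by omega)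
        (by omega) (by omega))
      (fun i j k _ _ _ hi hj hk => S i (by omega) j (by omega) k (by omega) hi hj hk (by omega)
        (by omega) (by omega) (by omega) (by omega) (by omega))
      (fun i _ h h' => B i (by omega) (i + 1) (by omega) (i + 2) (by omega) (i + 3) (by omega)
        h h' (by omega) (by omega) (by omega) (by omega) (by omega) (by omega) (by omega))
      (fun j k _ _ h h' hk _ => B' j (by omega) (j + 1) (by omega) (j + 2) (by omega) k (by omega)
        h h' hk (by omega) (by omega) (by omega) (by omega) (by omega) (by omega) (by omega)
        (by omega) (by omega))
      (fun j k _ _ h h' hk _ => B' (j + 2) (by omega) (j + 1) (by omega) j (by omega) k (by omega)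
        h' h hk (by omega) (by omega) (by omega) (by omega) (by omega) (by omega) (by omega)
        (by omega) (by omega))
      (fun h => by obtain ⟨j, hj, h⟩ := E₀ h; exact ⟨j, by omega, h⟩)
      (fun h => by obtain ⟨j, hj, h⟩ := E₁ h; exact ⟨j, by omega, h⟩)
      (fun h h' => by obtain ⟨j, hj, h⟩ := E₂ h h'; exact ⟨j, by omega, h⟩)
    refine ⟨i, by omega, fun j hj => ?_⟩
    rw [h j (by omega)]
    simp only [pathGraph_adj, Fin.ext_iff]
    omega
  · intro i
    by_cases h : (i : ℕ) = 0
    · exact ⟨⟨1, by omega⟩, by rw [pathGraph_adj]; simp [h]⟩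
    · exact ⟨⟨i - 1, by omega⟩, by rw [pathGraph_adj]; simp only; omega⟩
  · intro i j
    simp only [pathGraph_adj, ne_eq, Fin.ext_iff, Fin.forall_iff]
    by_cases hij : ((i : ℕ) ≤ 1 ∧ (j : ℕ) = 2) ∨ (n ≤ i + 1 ∧ (j : ℕ) + 2 = n)
    · exact .inr fun i' hi' h => interval_trace_separation hn j.2 hi' i.2 (by omega) h
    · exact .inl fun i' hi' h => interval_trace_separation hn i.2 hi' j.2 hij h

/-! ### A long induced path -/

theorem nonempty_pathGraph_five_embedding {a b c d e : V} (hac : a ≠ c) (had : a ≠ d) (hae : a ≠ e)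
    (hbd : b ≠ d) (hbe : b ≠ e) (hce : c ≠ e) (ab : G.Adj a b) (bc : G.Adj b c) (cd : G.Adj c d)
    (de : G.Adj d e) (nac : ¬ G.Adj a c) (nad : ¬ G.Adj a d) (nae : ¬ G.Adj a e)
    (nbd : ¬ G.Adj b d) (nbe : ¬ G.Adj b e) (nce : ¬ G.Adj c e) :
    Nonempty (pathGraph 5 ↪g G) := by
  refine ⟨⟨⟨![a, b, c, d, e], ?_⟩, ?_⟩⟩
  · have := ab.ne
    have := bc.ne
    have := cd.ne
    have := de.ne
    intro i j
    fin_cases i <;> fin_cases j <;> simp_all [eq_comm]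
  · intro i j
    change G.Adj (![a, b, c, d, e] i) (![a, b, c, d, e] j) ↔ _
    rw [pathGraph_adj]
    fin_cases i <;> fin_cases j <;> simp_all [G.adj_comm]

/-- Without an induced path on five vertices, nonadjacent vertices are at distance at most 3. -/
theorem Connected.exists_common_or_path (hG : G.Connected) (h5 : IsEmpty (pathGraph 5 ↪g G))
    (a b : V) : a = b ∨ G.Adj a b ∨ (∃ m, G.Adj a m ∧ G.Adj m b) ∨
      ∃ x y, G.Adj a x ∧ G.Adj x y ∧ G.Adj y b ∧ ¬ G.Adj a y ∧ ¬ G.Adj x b ∧ a ≠ y ∧ x ≠ b := by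
  revert b
  refine hG.induction_on_adj (a := a) (.inl rfl) ?_
  have := G.adj_comm
  rintro v w (rfl | h | ⟨m, h1, h2⟩ | ⟨x, y, h1, h2, h3, h4, h5, h6, h7⟩) hvw
  · grind
  · grind
  · grind
  · by_contra! h
    obtain ⟨n1, n2, n3, n4⟩ := h
    have n3x := n3 x h1
    have n4x := n4 x y h1 h2
    have n3v := n3 v
    refine not_nonempty_iff.2 ‹IsEmpty _› (nonempty_pathGraph_five_embedding (a := a) (b := x)
      (c := y) (d := v) (e := w) h6 ?_ n1 h7 ?_ ?_ h1 h2 h3 hvw h4 ?_ n2 h5 n3x ?_)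
    all_goals grind

theorem exists_pathGraph_five_embedding (hG : G.Connected) (hc : ClawFree G) (hb : BullFree G)
    {a b c : V} (hab : a ≠ b) (hac : a ≠ c) (hbc : b ≠ c) (nab : ¬ G.Adj a b) (nac : ¬ G.Adj a c)
    (nbc : ¬ G.Adj b c) : Nonempty (pathGraph 5 ↪g G) := by
  by_contra h5
  rw [not_nonempty_iff] at h5
  have two_common : ∀ {a b c m m' : V}, a ≠ b → a ≠ c → b ≠ c → ¬ G.Adj a b → ¬ G.Adj a c →
      ¬ G.Adj b c → G.Adj a m → G.Adj m b → G.Adj b m' → G.Adj m' c → False := by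
    intro a b c m m' hab hac hbc nab nac nbc am mb bm' m'c
    have nmc : ¬ G.Adj m c := fun h =>
      ClawFree.false_of_adj hc hab hac hbc am.symm mb h nab nac nbc
    have nam' : ¬ G.Adj a m' := fun h =>
      ClawFree.false_of_adj hc hab hac hbc h.symm bm'.symm m'c nab nac nbc
    have hmc : m ≠ c := fun h => nbc (h ▸ mb.symm)
    have ham' : a ≠ m' := fun h => nab (h ▸ bm'.symm)
    have hmm : m ≠ m' := fun h => nam' (h ▸ am)
    by_cases hmm' : G.Adj m m'
    · exact BullFree.false_of_adj hb hab.symm hbc hac hmm' bm'.symm mb.symm am.symm m'c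
        (fun h => nam' h.symm) (fun h => nab h.symm) nmc nbc nac
    · exact not_nonempty_iff.2 h5 (nonempty_pathGraph_five_embedding hab ham' hac
        hmm hmc hbc am mb bm' m'c nab nam' nac hmm' nmc nbc)
  have path_far : ∀ {a b c x y : V}, a ≠ b → a ≠ c → b ≠ c → ¬ G.Adj a b → ¬ G.Adj a c →
      ¬ G.Adj b c → G.Adj a x → G.Adj x y → G.Adj y c → ¬ G.Adj a y → ¬ G.Adj x c → a ≠ y →
      ¬ G.Adj x b := by
    intro a b c x y hab hac hbc nab nac nbc ax xy yc nay nxc hay xb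
    have hby : b ≠ y := fun h => nbc (h ▸ yc)
    by_cases yb : G.Adj y b
    · exact BullFree.false_of_adj hb hab.symm hbc hac xy yb xb.symm ax.symm yc
        (fun h => nay h.symm) (fun h => nab h.symm) nxc nbc nac
    · exact ClawFree.false_of_adj hc hab hay hby ax.symm xb xy nab nay (fun h => yb h.symm)
  have no_common : ∀ {a b c m : V}, a ≠ b → a ≠ c → b ≠ c → ¬ G.Adj a b → ¬ G.Adj a c →
      ¬ G.Adj b c → G.Adj a m → G.Adj m b → False := by
    intro a b c m hab hac hbc nab nac nbc am mb
    rcases hG.exists_common_or_path h5 a c with h | h | ⟨m', h1, h2⟩ |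
      ⟨x, y, ax, xy, yc, nay, nxc, hay, hxc⟩
    · exact hac h
    · exact nac h
    · exact two_common hab.symm hbc hac (fun h => nab h.symm) nbc nac mb.symm am.symm h1 h2
    have nxb := path_far hab hac hbc nab nac nbc ax xy yc nay nxc hay
    have nyb := path_far hbc.symm hac.symm hab.symm (fun h => nbc h.symm) (fun h => nac h.symm)
      (fun h => nab h.symm) yc.symm xy.symm ax.symm (fun h => nxc h.symm) (fun h => nay h.symm)
      hxc.symm
    have nmc : ¬ G.Adj m c := fun h =>
      ClawFree.false_of_adj hc hab hac hbc am.symm mb h nab nac nbc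
    have hby : b ≠ y := fun h => nbc (h ▸ yc)
    have hbx : b ≠ x := fun h => nab (h ▸ ax)
    have hmc : m ≠ c := fun h => nac (h ▸ am)
    have hmy : m ≠ y := fun h => nay (h ▸ am)
    have hmx : m ≠ x := fun h => nxb (h ▸ mb)
    have nmy : ¬ G.Adj m y := fun h =>
      ClawFree.false_of_adj hc hab hay hby am.symm mb h nab nay (fun h => nyb h.symm)
    by_cases mx : G.Adj m x
    · exact not_nonempty_iff.2 h5 (nonempty_pathGraph_five_embedding hbx hby hbc hmy hmc hxc
        mb.symm mx xy yc (fun h => nxb h.symm) (fun h => nyb h.symm) nbc nmy nmc nxc)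
    · exact not_nonempty_iff.2 h5 (nonempty_pathGraph_five_embedding hab.symm hbx hby hmx hmy hay
        mb.symm am.symm ax xy (fun h => nab h.symm) (fun h => nxb h.symm) (fun h => nyb h.symm)
        mx nmy nay)
  rcases hG.exists_common_or_path h5 a c with h | h | ⟨m', h1, h2⟩ |
      ⟨x, y, ax, xy, yc, nay, nxc, hay, hxc⟩
  · exact hac h
  · exact nac h
  · exact no_common hac hab hbc.symm nac nab (fun h => nbc h.symm) h1 h2
  · have nxb := path_far hab hac hbc nab nac nbc ax xy yc nay nxc hay
    have hbx : b ≠ x := fun h => nab (h ▸ ax)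
    exact no_common hxc hbx.symm hbc.symm nxc nxb (fun h => nbc h.symm) xy yc

/-- A connected (claw, bull)-free graph with a stable set of size three is an expansion of a long
path or of a long cycle. -/
theorem isPathExpansion_or_isCycleExpansion [Finite V] (hG : G.Connected) (hc : ClawFree G)
    (hb : BullFree G) {a b c : V} (hab : a ≠ b) (hac : a ≠ c) (hbc : b ≠ c) (nab : ¬ G.Adj a b)
    (nac : ¬ G.Adj a c) (nbc : ¬ G.Adj b c) :
    (∃ n : ℕ, 4 ≤ n ∧ IsPathExpansion G n) ∨ ∃ k : ℕ, 6 ≤ k ∧ IsCycleExpansion G k := by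
  classical
  have h5 := exists_pathGraph_five_embedding hG hc hb hab hac hbc nab nac nbc
  by_cases hcyc : ∃ k, 6 ≤ k ∧ Nonempty (circulantGraph ({1} : Set (ZMod k)) ↪g G)
  · obtain ⟨k, hk, ⟨p⟩⟩ := hcyc
    exact .inr ⟨k, hk, isCycleExpansion_of_embedding hG hc hb hk p⟩
  let P : ℕ → Prop := fun n => Nonempty (pathGraph (n + 1) ↪g G)
  have hbound : ∀ n, P n → n ≤ Nat.card V := fun n ⟨p⟩ => by
    have := Nat.card_le_card_of_injective p p.injective
    rw [Nat.card_fin] at this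
    omega
  have hspec : P (Nat.findGreatest P (Nat.card V)) := Nat.findGreatest_spec (hbound 4 h5) h5
  have hle : 4 ≤ Nat.findGreatest P (Nat.card V) := Nat.le_findGreatest (hbound 4 h5) h5
  obtain ⟨p⟩ := hspec
  refine .inl ⟨_, hle, isPathExpansion_of_embedding hG hc hb hle p ?_ ?_⟩
  · rw [← not_nonempty_iff]
    intro h
    have := Nat.le_findGreatest (P := P) (hbound _ h) h
    omega
  · rw [← not_nonempty_iff]
    exact fun h => hcyc ⟨_, by omega, h⟩

/-! ### Triangle-free graphs -/

theorem cliqueFree_three_iff_compl {H : SimpleGraph V} :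
    H.CliqueFree 3 ↔ ∀ a b c : V, a ≠ b → a ≠ c → b ≠ c → ¬ Hᶜ.Adj a b → ¬ Hᶜ.Adj a c →
      ¬ Hᶜ.Adj b c → False := by
  classical
  constructor
  · intro h a b c hab hac hbc nab nac nbc
    simp only [compl_adj, not_and, not_not] at nab nac nbc
    exact h {a, b, c} (is3Clique_triple_iff.2 ⟨nab hab, nac hac, nbc hbc⟩)
  · intro h s hs
    obtain ⟨a, b, c, hab, hac, hbc, -⟩ := is3Clique_iff.1 hs
    exact h a b c hab.ne hac.ne hbc.ne (by simp [hab]) (by simp [hac]) (by simp [hbc])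

theorem isCompleteBipartite_of_not_connected {H : SimpleGraph V}
    (h : ∀ a b c : V, a ≠ b → a ≠ c → b ≠ c → ¬ Hᶜ.Adj a b → ¬ Hᶜ.Adj a c →
      ¬ Hᶜ.Adj b c → False) (hcon : ¬ Hᶜ.Connected) : IsCompleteBipartite H := by
  rcases isEmpty_or_nonempty V with hV | hV
  · exact ⟨∅, fun x => hV.elim x⟩
  rw [connected_iff, not_and_or] at hcon
  obtain ⟨u, v, huv⟩ : ∃ u v, ¬ Hᶜ.Reachable u v := by
    simpa [Preconnected, hV] using hcon
  have key : ∀ x y, H.Adj x y → ∀ w, Hᶜ.Reachable w x ∨ Hᶜ.Reachable w y := by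
    intro x y hxy w
    by_contra! hw
    have hx : w ≠ x := fun e => hw.1 (e ▸ Reachable.refl _)
    have hy : w ≠ y := fun e => hw.2 (e ▸ Reachable.refl _)
    exact h w x y hx hy hxy.ne (fun e => hw.1 e.reachable) (fun e => hw.2 e.reachable)
      (by simp [hxy])
  have hadj : ∀ x y, Hᶜ.Reachable u x → ¬ Hᶜ.Reachable u y → H.Adj x y := by
    intro x y hx hy
    by_contra hxy
    have hne : x ≠ y := fun e => hy (e ▸ hx)
    exact hy (hx.trans (Adj.reachable ((compl_adj ..).2 ⟨hne, hxy⟩)))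
  refine ⟨{w | Hᶜ.Reachable u w}, fun x y => ⟨fun hxy => ?_, ?_⟩⟩
  · simp only [Set.mem_ofPred_eq]
    have h1 := key x y hxy u
    have h2 := key x y hxy v
    by_cases hx : Hᶜ.Reachable u x <;> by_cases hy : Hᶜ.Reachable u y
    · rcases h2 with h2 | h2
      · exact absurd (hx.trans h2.symm) huv
      · exact absurd (hy.trans h2.symm) huv
    · exact .inl ⟨hx, hy⟩
    · exact .inr ⟨hx, hy⟩
    · exact absurd h1 (by simp [hx, hy])
  · rintro (⟨hx, hy⟩ | ⟨hx, hy⟩)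
    · exact hadj x y hx hy
    · exact (hadj y x hy hx).symm

end SimpleGraph

open SimpleGraph in
/-- A graph is triangle-free iff it is complete bipartite or its complement is a connected
(claw, bull)-free graph which is neither an expansion of a path of length at least 4 nor an
expansion of a cycle of length at least 6. -/
theorem triangleFree_iff {V : Type*} [Fintype V] (H : SimpleGraph V) :
    H.CliqueFree 3 ↔
      (IsCompleteBipartite H ∨
        (Hᶜ.Connected ∧ ClawFree Hᶜ ∧ BullFree Hᶜ ∧
          ¬ (∃ n : ℕ, 4 ≤ n ∧ IsPathExpansion Hᶜ n) ∧
          ¬ (∃ k : ℕ, 6 ≤ k ∧ IsCycleExpansion Hᶜ k))) := by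
  rw [cliqueFree_three_iff_compl]
  constructor
  · intro h
    by_cases hcon : Hᶜ.Connected
    · refine .inr ⟨hcon, ?_, ?_, ?_, ?_⟩
      · rintro ⟨v, a, b, c, hab, hac, hbc, -, -, -, nab, nac, nbc⟩
        exact h a b c hab hac hbc nab nac nbc
      · rintro ⟨a, b, c, d, e, -, -, hcd, hce, hde, -, -, -, -, -, -, ncd, -, nce, nde⟩
        exact h c d e hcd hce hde ncd nce nde
      · rintro ⟨n, hn, f, hf, hadj⟩
        obtain ⟨a, ha⟩ := hf ⟨0, by omega⟩
        obtain ⟨b, hb⟩ := hf ⟨2, by omega⟩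
        obtain ⟨c, hc⟩ := hf ⟨4, by omega⟩
        have hab : a ≠ b := by rintro rfl; simp [ha] at hb
        have hac : a ≠ c := by rintro rfl; simp [ha] at hc
        have hbc : b ≠ c := by rintro rfl; simp [hb] at hc
        exact h a b c hab hac hbc (by simp [hadj a b hab, ha, hb]) (by simp [hadj a c hac, ha, hc])
          (by simp [hadj b c hbc, hb, hc])
      · rintro ⟨k, hk, f, hf, hadj⟩
        obtain ⟨h1, h2, h3, h4, h5⟩ := zmod_small_ne_zero hk
        obtain ⟨a, ha⟩ := hf 0
        obtain ⟨b, hb⟩ := hf 2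
        obtain ⟨c, hc⟩ := hf 4
        have hab : a ≠ b := by rintro rfl; exact h2 (hb.symm.trans ha)
        have hac : a ≠ c := by rintro rfl; exact h4 (hc.symm.trans ha)
        have hbc : b ≠ c := by rintro rfl; exact h2 (by linear_combination hb - hc)
        refine h a b c hab hac hbc ?_ ?_ ?_
        · rw [hadj a b hab, ha, hb]
          rintro (e | e | e)
          · exact h2 e.symm
          · exact h3 (by linear_combination -e)
          · exact h1 (by linear_combination e)
        · rw [hadj a c hac, ha, hc]
          rintro (e | e | e)
          · exact h4 e.symm
          · exact h5 (by linear_combination -e)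
          · exact h3 (by linear_combination e)
        · rw [hadj b c hbc, hb, hc]
          rintro (e | e | e)
          · exact h2 (by linear_combination -e)
          · exact h3 (by linear_combination -e)
          · exact h1 (by linear_combination e)
    · exact .inl (isCompleteBipartite_of_not_connected h hcon)
  · rintro (⟨A, hA⟩ | ⟨hcon, hc, hb, hp, hk⟩) a b c hab hac hbc nab nac nbc
    · simp only [compl_adj, not_and, not_not] at nab nac nbc
      have h1 := (hA a b).1 (nab hab)
      have h2 := (hA a c).1 (nac hac)
      have h3 := (hA b c).1 (nbc hbc)
      tauto
    · rcases isPathExpansion_or_isCycleExpansion hcon hc hb hab hac hbc nab nac nbc with h | h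
      · exact hp h
      · exact hk h
end
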